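/- arXiv:1901.02516 — 4 statements merged into one kernel-verified Lean document; each statement's English description precedes it below -/
import Mathlib

section
/- Let B be a unital C*-algebra, D a C*-subalgebra of B containing the unit of B, and A a subspace of B with D·A·D ⊆ A. Let T : A → D be a bounded linear D-bimodule map. Then for every n ≥ 1 and every n×n matrix x = [x_{ij}] whose entries lie in A, one has ‖[T(x_{ij})]‖ ≤ ‖T‖·‖[x_{ij}]‖, where both matrices are normed as elements of the C*-algebra M_n(B). In particular the completely bounded norm of T equals ‖T‖, and every unital contractive algebra homomorphism Φ : A → D (with A a unital subalgebra of B containing D) whose restriction to D is the identity is completely contractive: ‖[Φ(x_{ij})]‖ ≤ ‖[x_{ij}]‖ for all such matrices. -/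
/-- `ν` is a C*-norm on the `*`-algebra of `n × n` matrices over `B`; since a `*`-algebra which
is complete in some C*-norm (as `Mₙ(B)` is) admits a unique C*-norm, this pins down the norm of
the C*-algebra `Mₙ(B)`. -/
def IsCStarNormOnMatrices {B : Type*} [CStarAlgebra B] {n : ℕ}
    (ν : Matrix (Fin n) (Fin n) B → ℝ) : Prop :=
  (∀ m₁ m₂ : Matrix (Fin n) (Fin n) B, ν (m₁ + m₂) ≤ ν m₁ + ν m₂) ∧
    (∀ (c : ℂ) (m : Matrix (Fin n) (Fin n) B), ν (c • m) = ‖c‖ * ν m) ∧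
    (∀ m₁ m₂ : Matrix (Fin n) (Fin n) B, ν (m₁ * m₂) ≤ ν m₁ * ν m₂) ∧
    (∀ m : Matrix (Fin n) (Fin n) B, ν (star m * m) = ν m ^ 2) ∧
    (∀ m : Matrix (Fin n) (Fin n) B, ν m = 0 → m = 0)

/-- `ν` is a C*-norm, possibly incomplete, on the complex `*`-algebra `R`. -/
structure IsCStarNorm {R : Type*} [Ring R] [Star R] [Module ℂ R] (ν : R → ℝ) : Prop where
  add_le : ∀ a b, ν (a + b) ≤ ν a + ν b
  smul : ∀ (c : ℂ) a, ν (c • a) = ‖c‖ * ν a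
  mul_le : ∀ a b, ν (a * b) ≤ ν a * ν b
  star_mul_self : ∀ a, ν (star a * a) = ν a ^ 2
  eq_zero : ∀ a, ν a = 0 → a = 0

theorem IsCStarNormOnMatrices.isCStarNorm {B : Type*} [CStarAlgebra B] {n : ℕ}
    {ν : Matrix (Fin n) (Fin n) B → ℝ} (h : IsCStarNormOnMatrices ν) : IsCStarNorm ν :=
  ⟨h.1, h.2.1, h.2.2.1, h.2.2.2.1, h.2.2.2.2⟩

namespace IsCStarNorm

section Algebraic

variable {R S : Type*} [Ring R] [StarRing R] [Module ℂ R] [Ring S] [StarRing S] [Module ℂ S]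
  {ν : R → ℝ}

protected theorem map_zero (h : IsCStarNorm ν) : ν 0 = 0 := by
  simpa using h.smul 0 0

theorem nonneg (h : IsCStarNorm ν) (a : R) : 0 ≤ ν a := by
  have h₁ := h.add_le a ((-1 : ℂ) • a)
  rw [h.smul] at h₁
  simp [h.map_zero] at h₁
  linarith

theorem le_map_star (h : IsCStarNorm ν) (a : R) : ν a ≤ ν (star a) := by
  rcases (h.nonneg a).eq_or_lt with h₀ | h₀
  · exact h₀ ▸ h.nonneg _
  · have h₁ := h.mul_le (star a) a
    rw [h.star_mul_self, sq] at h₁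
    exact le_of_mul_le_mul_right h₁ h₀

protected theorem map_star (h : IsCStarNorm ν) (a : R) : ν (star a) = ν a :=
  le_antisymm (by simpa using h.le_map_star (star a)) (h.le_map_star a)

theorem mul_star_self (h : IsCStarNorm ν) (a : R) : ν (a * star a) = ν a ^ 2 := by
  simpa [h.map_star] using h.star_mul_self (star a)

/-- The pullback of a C*-norm along an injective `*`-homomorphism is a C*-norm. -/
theorem comp (h : IsCStarNorm ν) (f : S →⋆ₙₐ[ℂ] R) (hf : Function.Injective f) :
    IsCStarNorm fun a => ν (f a) where
  add_le a b := by simpa using h.add_le (f a) (f b)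
  smul c a := by simpa using h.smul c (f a)
  mul_le a b := by simpa using h.mul_le (f a) (f b)
  star_mul_self a := by simpa [map_star] using h.star_mul_self (f a)
  eq_zero a ha := (map_eq_zero_iff f hf).1 (h.eq_zero _ ha)

theorem map_one_le (h : IsCStarNorm ν) : ν 1 ≤ 1 := by
  have h₁ := h.star_mul_self 1
  simp only [star_one, mul_one] at h₁
  nlinarith [sq_nonneg (ν 1 - 1)]

theorem map_unitary_le (h : IsCStarNorm ν) (u : unitary R) : ν (u : R) ≤ 1 := by
  have h₁ := h.star_mul_self (u : R)
  rw [Unitary.coe_star_mul_self] at h₁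
  nlinarith [h.map_one_le]

end Algebraic

section Complete

variable {A : Type*} [CStarAlgebra A] {ν : A → ℝ}

theorem le_norm_of_isSelfAdjoint (h : IsCStarNorm ν) {a : A} (ha : IsSelfAdjoint a) :
    ν a ≤ ‖a‖ := by
  let _ := CStarAlgebra.spectralOrder A
  let _ := CStarAlgebra.spectralOrderedRing A
  have unit_ball : ∀ b : selfAdjoint A, ‖b‖ ≤ 1 → ν (b : A) ≤ 1 := by
    intro b hb
    let u := selfAdjoint.unitarySelfAddISMul b hb
    have hu : (b : A) = (2⁻¹ : ℂ) • ((u : A) + (star u : unitary A)) := by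
      have hstar := selfAdjoint.star_coe_unitarySelfAddISMul b hb
      rw [← Unitary.coe_star] at hstar
      rw [hstar, selfAdjoint.unitarySelfAddISMul_coe, add_add_sub_cancel, ← two_smul ℂ, smul_smul]
      simp
    rw [hu, h.smul]
    have h₁ := h.add_le (u : A) (star u : unitary A)
    have h₂ := h.map_unitary_le u
    have h₃ := h.map_unitary_le (star u)
    rw [norm_inv, Complex.norm_ofNat]
    linarith
  rcases eq_or_ne a 0 with rfl | h₀
  · simp [h.map_zero]
  · have hpos : 0 < ‖a‖ := norm_pos_iff.2 h₀
    have h₁ := unit_ball (‖a‖⁻¹ • ⟨a, ha⟩) (by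
      rw [norm_smul, norm_inv, norm_norm]
      exact (inv_mul_cancel₀ hpos.ne').le)
    have h₂ : ((‖a‖⁻¹ • (⟨a, ha⟩ : selfAdjoint A) : selfAdjoint A) : A)
        = ((‖a‖⁻¹ : ℝ) : ℂ) • a := by
      rw [selfAdjoint.val_smul, Complex.coe_smul]
    rw [h₂, h.smul, Complex.norm_real, norm_inv, norm_norm, inv_mul_le_iff₀ hpos] at h₁
    simpa using h₁

/-- Every C*-norm on a C*-algebra is dominated by the complete one. -/
theorem le_norm (h : IsCStarNorm ν) (a : A) : ν a ≤ ‖a‖ := by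
  have h₁ := h.le_norm_of_isSelfAdjoint (IsSelfAdjoint.star_mul_self a)
  rw [h.star_mul_self, CStarRing.norm_star_mul_self, ← sq] at h₁
  exact le_of_sq_le_sq h₁ (norm_nonneg a)

theorem norm_star_mul_self_le (h : IsCStarNorm ν) (b : A) : ‖star b * b‖ ≤ ν (star b * b) := by
  let _ := CStarAlgebra.spectralOrder A
  let _ := CStarAlgebra.spectralOrderedRing A
  set a := star b * b with ha_def
  have ha : 0 ≤ a := star_mul_self_nonneg b
  by_contra! hlt
  have : Nontrivial A := nontrivial_of_ne a 0 (norm_pos_iff.1 ((h.nonneg a).trans_lt hlt))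
  obtain ⟨r, har, hra⟩ := exists_between hlt
  have hr : 0 < r := (h.nonneg a).trans_lt har
  have hmax : ∀ t : ℝ, 0 < max t r := fun t => hr.trans_le (le_max_right t r)
  have hg : Continuous fun t : ℝ => (max t r)⁻¹ :=
    (continuous_id.max continuous_const).inv₀ fun t => (hmax t).ne'
  have hf : Continuous fun t : ℝ => max (t - r) 0 := by fun_prop
  have factor : cfc (fun t : ℝ => max (t - r) 0) a
      = cfc (fun t : ℝ => (max t r)⁻¹) a * (a * cfc (fun t : ℝ => max (t - r) 0) a) := by
    have h₁ : a * cfc (fun t : ℝ => max (t - r) 0) a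
        = cfc (fun t : ℝ => t * max (t - r) 0) a := by
      rw [cfc_mul (fun t : ℝ => t) (fun t : ℝ => max (t - r) 0) a, cfc_id' ℝ a]
    rw [h₁, ← cfc_mul (fun t : ℝ => (max t r)⁻¹) (fun t : ℝ => t * max (t - r) 0) a
      hg.continuousOn]
    congr 1
    ext t
    rcases le_total t r with ht | ht
    · simp [max_eq_right (sub_nonpos.2 ht)]
    · rw [max_eq_left ht, inv_mul_cancel_left₀ (hr.trans_le ht).ne']
  have hne : cfc (fun t : ℝ => max (t - r) 0) a ≠ 0 := by
    intro h₀
    have hmem := CStarAlgebra.norm_mem_spectrum_of_nonneg ha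
    have h₁ : max (‖a‖ - r) 0 ∈ spectrum ℝ (cfc (fun t : ℝ => max (t - r) 0) a) := by
      rw [cfc_map_spectrum (R := ℝ) (fun t : ℝ => max (t - r) 0) a (.of_nonneg ha)]
      exact ⟨_, hmem, rfl⟩
    rw [h₀, spectrum.zero_eq, Set.mem_singleton_iff, max_eq_left (by linarith)] at h₁
    linarith
  have hgle : ν (cfc (fun t : ℝ => (max t r)⁻¹) a) ≤ r⁻¹ := by
    refine (h.le_norm _).trans (norm_cfc_le (by positivity) fun t _ => ?_)
    rw [Real.norm_of_nonneg (inv_nonneg.2 (hmax t).le)]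
    exact inv_anti₀ hr (le_max_right t r)
  have hpos : 0 < ν (cfc (fun t : ℝ => max (t - r) 0) a) :=
    (h.nonneg _).lt_of_ne fun h₀ => hne (h.eq_zero _ h₀.symm)
  set F := cfc (fun t : ℝ => max (t - r) 0) a
  have : ν F < ν F := calc
    ν F ≤ ν (cfc (fun t : ℝ => (max t r)⁻¹) a) * ν (a * F) := by
      conv_lhs => rw [factor]
      exact h.mul_le _ _
    _ ≤ r⁻¹ * (ν a * ν F) := by
      gcongr
      · exact h.nonneg _
      · exact h.mul_le _ _
    _ < r⁻¹ * (r * ν F) := by gcongr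
    _ = ν F := by field_simp
  exact this.false

/-- A C*-algebra has a unique C*-norm. -/
theorem eq_norm (h : IsCStarNorm ν) (a : A) : ν a = ‖a‖ := by
  refine le_antisymm (h.le_norm a) (le_of_sq_le_sq ?_ (h.nonneg a))
  rw [← h.star_mul_self, sq, ← CStarRing.norm_star_mul_self]
  exact h.norm_star_mul_self_le a

end Complete

end IsCStarNorm

section Matrices

variable {n B : Type*} [Fintype n] [DecidableEq n]

/-- The embedding of an algebra into matrices as a diagonal corner. -/
def Matrix.singleStarHom [CStarAlgebra B] (i : n) : B →⋆ₙₐ[ℂ] Matrix n n B where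
  toFun := Matrix.single i i
  map_smul' c b := (Matrix.smul_single c i i b).symm
  map_zero' := Matrix.single_zero i i
  map_add' := Matrix.single_add i i
  map_mul' a b := by simp
  map_star' b := by simp [Matrix.star_eq_conjTranspose, Matrix.conjTranspose_single]

variable [CStarAlgebra B] {ν : Matrix n n B → ℝ}

theorem IsCStarNorm.map_single (h : IsCStarNorm ν) (i : n) (b : B) :
    ν (Matrix.single i i b) = ‖b‖ :=
  (h.comp (Matrix.singleStarHom i) fun a b hab => by
    simpa using congrFun (congrFun (show Matrix.single i i a = Matrix.single i i b from hab) i) i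
    ).eq_norm b

/-- The matrix whose `i`-th row is `v` and whose other rows vanish. -/
def Matrix.rowAt (i : n) (v : n → B) : Matrix n n B :=
  Matrix.of fun k j => if i = k then v j else 0

theorem Matrix.rowAt_mul_mul_star_rowAt (i : n) (x : Matrix n n B) (v w : n → B) :
    rowAt i v * x * star (rowAt i w)
      = Matrix.single i i (∑ j, ∑ k, v k * x k j * star (w j)) := by
  ext k l
  rcases eq_or_ne i k with rfl | hk <;> rcases eq_or_ne i l with rfl | hl <;>
    simp [rowAt, Matrix.mul_apply, Matrix.star_apply, Finset.sum_mul, *]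

theorem IsCStarNorm.map_rowAt (h : IsCStarNorm ν) (i : n) (v : n → B) :
    ν (Matrix.rowAt i v) = √‖∑ j, v j * star (v j)‖ := by
  have h₁ := Matrix.rowAt_mul_mul_star_rowAt i 1 v v
  simp only [mul_one, Matrix.one_apply, mul_ite, mul_zero, ite_mul, zero_mul, Finset.sum_ite_eq',
    Finset.mem_univ, if_true] at h₁
  rw [← h.map_single i, ← h₁, h.mul_star_self, Real.sqrt_sq (h.nonneg _)]

/-- Compressing a matrix by a row on the left and a column on the right. -/
theorem IsCStarNorm.norm_sum_mul_mul_star_le [Nonempty n] (h : IsCStarNorm ν)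
    (x : Matrix n n B) (v w : n → B) :
    ‖∑ j, ∑ k, v k * x k j * star (w j)‖
      ≤ ν x * √‖∑ j, v j * star (v j)‖ * √‖∑ j, w j * star (w j)‖ := by
  obtain ⟨i⟩ := ‹Nonempty n›
  rw [← h.map_single i, ← Matrix.rowAt_mul_mul_star_rowAt, ← h.map_rowAt i, ← h.map_rowAt i]
  calc _ ≤ ν (Matrix.rowAt i v * x) * ν (star (Matrix.rowAt i w)) := h.mul_le _ _
    _ ≤ ν (Matrix.rowAt i v) * ν x * ν (Matrix.rowAt i w) := by
      rw [h.map_star]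
      exact mul_le_mul_of_nonneg_right (h.mul_le _ _) (h.nonneg _)
    _ = _ := by ring

/-- The norm of a matrix over a C*-subalgebra `D` is determined by its compressions by rows and
columns over `D`. -/
theorem IsCStarNorm.le_of_norm_sum_mul_mul_star_le (h : IsCStarNorm ν) (D : StarSubalgebra ℂ B)
    (hD : IsClosed (D : Set B)) (y : n → n → D) {C : ℝ} (hC : 0 ≤ C)
    (hy : ∀ v w : n → D, ‖∑ j, ∑ k, (v k : B) * y k j * star (w j : B)‖
      ≤ C * √‖∑ j, (v j : B) * star (v j : B)‖ * √‖∑ j, (w j : B) * star (w j : B)‖) :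
    ν (Matrix.of fun i j => (y i j : B)) ≤ C := by
  have : IsClosed (D : Set B) := hD
  let _ : CStarAlgebra D := StarSubalgebra.cstarAlgebra D
  let _ := CStarAlgebra.spectralOrder D
  let _ := CStarAlgebra.spectralOrderedRing D
  let f : CStarMatrix n n D →⋆ₙₐ[ℂ] Matrix n n B :=
    ((CStarMatrix.ofMatrixStarAlgEquiv (n := n) (A := B)).symm : _ →⋆ₙₐ[ℂ] _).comp
      (CStarMatrix.mapₙₐ (D.subtype : D →⋆ₙₐ[ℂ] B))
  have hf : Function.Injective f := fun M N hMN => by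
    ext i j
    exact congrFun (congrFun hMN i) j
  refine ((h.comp f hf).le_norm (CStarMatrix.ofMatrix (Matrix.of y))).trans ?_
  lift C to NNReal using hC
  refine CStarMatrix.norm_le_of_forall_inner_le fun v w => ?_
  have hnorm : ∀ u : n → D, ‖∑ j, (u j : B) * star (u j : B)‖ = ‖∑ j, u j * star (u j)‖ :=
    fun u => by
      simp [← StarMemClass.coe_star, ← MulMemClass.coe_mul, ← AddSubmonoidClass.coe_finsetSum]
  have hinner : ∀ v w : n → D, ‖∑ j, ∑ k, (v k : B) * y k j * star (w j : B)‖
      = ‖∑ j, (∑ k, v k * y k j) * star (w j)‖ := fun v w => by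
    simp [← StarMemClass.coe_star, ← MulMemClass.coe_mul, ← AddSubmonoidClass.coe_finsetSum,
      Finset.sum_mul]
  simp only [hnorm, hinner] at hy
  rw [WithCStarModule.pi_norm, WithCStarModule.pi_norm, WithCStarModule.pi_inner,
    CStarMatrix.toCLM_apply_eq_sum]
  exact hy (WithCStarModule.equiv _ _ v) (WithCStarModule.equiv _ _ w)

end Matrices

/-- Let `B` be a unital C*-algebra, `D` a C*-subalgebra of `B` containing the
unit, and `A` a subspace of `B` with `D·A·D ⊆ A`. If `T : A → D` is a bounded linear
`D`-bimodule map, then for every `n ≥ 1` and every `n × n` matrix `x` with entries in `A` we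
have `‖[T(x_{ij})]‖ ≤ ‖T‖·‖[x_{ij}]‖` in the C*-algebra `Mₙ(B)`; in particular
`‖T‖_cb = ‖T‖`. Moreover every unital contractive algebra homomorphism `Φ : A → D` (with `A` a
unital subalgebra of `B` containing `D`) restricting to the identity on `D` is completely
contractive. -/
theorem bimodule_maps_completely_bounded
    {B : Type*} [CStarAlgebra B]
    (D : StarSubalgebra ℂ B)
    (hDclosed : IsClosed (D : Set B)) :
    (∀ A : Submodule ℂ B,
      (∀ d₁ ∈ D, ∀ d₂ ∈ D, ∀ a ∈ A, d₁ * a * d₂ ∈ A) →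
      ∀ T : ↥A →L[ℂ] B,
        (∀ a : ↥A, T a ∈ D) →
        (∀ d₁ : B, d₁ ∈ D → ∀ d₂ : B, d₂ ∈ D → ∀ a : ↥A, ∀ h : d₁ * (a : B) * d₂ ∈ A,
          T ⟨d₁ * (a : B) * d₂, h⟩ = d₁ * T a * d₂) →
        ∀ n : ℕ, 1 ≤ n → ∀ ν : Matrix (Fin n) (Fin n) B → ℝ, IsCStarNormOnMatrices ν →
          ∀ x : Matrix (Fin n) (Fin n) ↥A,
            ν (Matrix.of fun i j => (T (x i j) : B)) ≤
              ‖T‖ * ν (Matrix.of fun i j => ((x i j : B)))) ∧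
    (∀ A : Subalgebra ℂ B, ∀ hDA : D.toSubalgebra ≤ A, ∀ Φ : ↥A →ₐ[ℂ] B,
      (∀ a : ↥A, Φ a ∈ D) →
      (∀ a : ↥A, ‖Φ a‖ ≤ ‖(a : B)‖) →
      (∀ d : B, ∀ hd : d ∈ D, Φ ⟨d, hDA hd⟩ = d) →
      ∀ n : ℕ, 1 ≤ n → ∀ ν : Matrix (Fin n) (Fin n) B → ℝ, IsCStarNormOnMatrices ν →
        ∀ x : Matrix (Fin n) (Fin n) ↥A,
          ν (Matrix.of fun i j => (Φ (x i j) : B)) ≤ ν (Matrix.of fun i j => ((x i j : B)))) := by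
  have bimodule : ∀ A : Submodule ℂ B,
      (∀ d₁ ∈ D, ∀ d₂ ∈ D, ∀ a ∈ A, d₁ * a * d₂ ∈ A) →
      ∀ T : ↥A →L[ℂ] B,
        (∀ a : ↥A, T a ∈ D) →
        (∀ d₁ : B, d₁ ∈ D → ∀ d₂ : B, d₂ ∈ D → ∀ a : ↥A, ∀ h : d₁ * (a : B) * d₂ ∈ A,
          T ⟨d₁ * (a : B) * d₂, h⟩ = d₁ * T a * d₂) →
        ∀ n : ℕ, 1 ≤ n → ∀ ν : Matrix (Fin n) (Fin n) B → ℝ, IsCStarNormOnMatrices ν →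
          ∀ x : Matrix (Fin n) (Fin n) ↥A,
            ν (Matrix.of fun i j => (T (x i j) : B)) ≤
              ‖T‖ * ν (Matrix.of fun i j => ((x i j : B))) := by
    intro A hA T hTD hT n hn ν hν x
    have : Nonempty (Fin n) := ⟨⟨0, hn⟩⟩
    have hν := hν.isCStarNorm
    refine hν.le_of_norm_sum_mul_mul_star_le D hDclosed (fun i j => ⟨T (x i j), hTD _⟩)
      (mul_nonneg (norm_nonneg T) (hν.nonneg _)) fun v w => ?_
    have hmem : ∀ k j, (v k : B) * (x k j : B) * star (w j : B) ∈ A := fun k j =>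
      hA _ (v k).2 _ (star_mem (w j).2) _ (x k j).2
    have hsum : ∑ j, ∑ k, (v k : B) * T (x k j) * star (w j : B)
        = T (∑ j, ∑ k, ⟨_, hmem k j⟩) := by
      simp only [map_sum, hT _ (v _).2 _ (star_mem (w _).2)]
    have hcompress := hν.norm_sum_mul_mul_star_le (Matrix.of fun i j => (x i j : B))
      (fun j => (v j : B)) (fun j => (w j : B))
    calc ‖∑ j, ∑ k, (v k : B) * T (x k j) * star (w j : B)‖
        ≤ ‖T‖ * ‖∑ j, ∑ k, (v k : B) * (x k j : B) * star (w j : B)‖ := by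
          rw [hsum]
          refine (T.le_opNorm _).trans_eq ?_
          rw [Submodule.coe_norm, AddSubmonoidClass.coe_finsetSum]
          simp only [AddSubmonoidClass.coe_finsetSum]
      _ ≤ _ := (mul_le_mul_of_nonneg_left hcompress (norm_nonneg T)).trans_eq (by ring)
  refine ⟨bimodule, fun A hDA Φ hΦD hΦ hΦid n hn ν hν x => ?_⟩
  let T : ↥A.toSubmodule →L[ℂ] B := LinearMap.mkContinuous (Φ.toLinearMap) 1 fun a => by
    simpa using hΦ a
  have hT : ‖T‖ ≤ 1 := LinearMap.mkContinuous_norm_le _ zero_le_one _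
  have key := bimodule A.toSubmodule
    (fun d₁ h₁ d₂ h₂ a ha => A.mul_mem (A.mul_mem (hDA h₁) ha) (hDA h₂)) T hΦD
    (fun d₁ h₁ d₂ h₂ a h => by
      have h₃ : Φ (⟨d₁, hDA h₁⟩ * a * ⟨d₂, hDA h₂⟩) = d₁ * Φ a * d₂ := by
        rw [map_mul, map_mul, hΦid _ h₁, hΦid _ h₂]
      exact h₃) n hn ν hν x
  exact key.trans (mul_le_of_le_one_left (hν.isCStarNorm.nonneg _) hT)
end

section
/- Let τ be a tracial state on a unital C*-algebra B and let Δ_τ be the associated Fuglede–Kadison determinant. Then Δ_τ is multiplicative: Δ_τ(ab) = Δ_τ(a)·Δ_τ(b) for all a, b ∈ B. -/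
open scoped ComplexOrder

/-- The absolute value `|a| = (a*a)^{1/2}` in a C*-algebra. -/
noncomputable def cstarAbs {M : Type*} [CStarAlgebra M] [PartialOrder M] [StarOrderedRing M]
    (a : M) : M :=
  CFC.sqrt (star a * a)

/-- The Fuglede–Kadison determinant associated to a tracial state `τ`:
`Δ_τ(a) = inf_{ε>0} exp(τ(log(|a| + ε·1)))`. -/
noncomputable def fkDet {M : Type*} [CStarAlgebra M] [PartialOrder M] [StarOrderedRing M]
    (τ : M →ₗ[ℂ] ℂ) (a : M) : ℝ :=
  ⨅ ε : {ε : ℝ // 0 < ε}, Real.exp ((τ (CFC.log (cstarAbs a + (ε : ℝ) • 1))).re)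

open Filter Topology

section
variable {B : Type*} [CStarAlgebra B]

theorem CFC.hasSum_log_of_norm_one_sub_lt_one {c : B} (hc : IsSelfAdjoint c)
    (h : ‖1 - c‖ < 1) :
    HasSum (fun n : ℕ => ((n : ℝ) + 1)⁻¹ • (1 - c) ^ (n + 1)) (-CFC.log c) := by
  cases subsingleton_or_nontrivial B
  · convert hasSum_zero using 1
  have hsum : Summable (fun n : ℕ => ‖1 - c‖ ^ (n + 1)) :=
    (summable_nat_add_iff 1).2 (summable_geometric_of_lt_one (norm_nonneg _) h)
  have hcoef (n : ℕ) : ((n : ℝ) + 1)⁻¹ ≤ 1 := inv_le_one_of_one_le₀ (by simp)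
  have hspec : ∀ x ∈ spectrum ℝ c, |1 - x| ≤ ‖1 - c‖ := by
    intro x hx
    have hx' : 1 - x ∈ spectrum ℝ (1 - c) := by
      simpa using (spectrum.singleton_sub_eq (R := ℝ) c 1).subset
        (Set.sub_mem_sub (Set.mem_singleton 1) hx)
    exact spectrum.norm_le_norm_of_mem hx'
  have hpartial (N : ℕ) : ∑ n ∈ Finset.range N, ((n : ℝ) + 1)⁻¹ • (1 - c) ^ (n + 1) =
      cfc (fun x : ℝ => ∑ n ∈ Finset.range N, ((n : ℝ) + 1)⁻¹ • (1 - x) ^ (n + 1)) c := by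
    rw [← Finset.sum_fn, cfc_sum _ _ _ fun n _ => by fun_prop]
    refine Finset.sum_congr rfl fun n _ => ?_
    rw [cfc_smul .., cfc_pow .., cfc_sub .., cfc_const_one .., cfc_id' ..]
  rw [Summable.hasSum_iff_tendsto_nat]
  · simp_rw [hpartial]
    rw [CFC.log, ← cfc_neg]
    refine tendsto_cfc_fun ?_ (.of_forall fun N => by fun_prop)
    refine (tendstoUniformlyOn_tsum_nat hsum fun n x hx => ?_).congr_right fun x hx => ?_
    · rw [norm_smul, norm_pow, Real.norm_of_nonneg (by positivity)]
      exact (mul_le_of_le_one_left (by positivity) (hcoef n)).trans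
        (pow_le_pow_left₀ (norm_nonneg _) (hspec x hx) _)
    · have := (Real.hasSum_pow_div_log_of_abs_lt_one ((hspec x hx).trans_lt h)).tsum_eq
      simp only [sub_sub_cancel] at this
      simp only [← this, smul_eq_mul, inv_mul_eq_div]
  · refine .of_norm_bounded hsum fun n => ?_
    rw [norm_smul, Real.norm_of_nonneg (by positivity)]
    exact (mul_le_of_le_one_left (by positivity) (hcoef n)).trans (norm_pow_le _ _)

theorem hasDerivAt_apply_pow (T : B →L[ℝ] ℝ) (hT : ∀ a b, T (a * b) = T (b * a))
    {x : ℝ → B} {x' : B} {t : ℝ} (hx : HasDerivAt x x' t) (n : ℕ) :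
    HasDerivAt (fun s => T (x s ^ (n + 1))) ((n + 1) * T (x t ^ n * x')) t := by
  have hpow := T.hasFDerivAt.comp_hasDerivAt t (hx.hasFDerivAt.pow' (n + 1)).hasDerivAt
  refine hpow.congr_deriv ?_
  simp only [sum_apply, map_sum]
  rw [Finset.sum_congr rfl (g := fun _ => T (x t ^ n * x'))]
  · simp
  · intro i hi
    have hi' : i ≤ n := by simpa [Nat.lt_succ_iff] using hi
    simp
    rw [hT, ← mul_assoc, ← pow_add, Nat.add_sub_cancel' hi']

variable [PartialOrder B] [StarOrderedRing B]

theorem IsStrictlyPositive.norm_one_sub_smul_lt_one {c : B} (hc : IsStrictlyPositive c) {K : ℝ}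
    (hK : 0 < K) (hcK : ‖c‖ ≤ K) : ‖1 - K⁻¹ • c‖ < 1 := by
  nontriviality B
  have hcsa : IsSelfAdjoint c := .of_nonneg hc.nonneg
  obtain ⟨δ, hδ, hδc⟩ := (CFC.exists_pos_algebraMap_le_iff hcsa).2
    fun x hx => hc.spectrum_pos hx
  have hle : K⁻¹ • c ≤ 1 := by
    have : c ≤ algebraMap ℝ B K :=
      hcsa.le_algebraMap_norm_self.trans (algebraMap_mono B hcK)
    simpa [Algebra.algebraMap_eq_smul_one, smul_smul, hK.ne'] using
      smul_le_smul_of_nonneg_left this (inv_nonneg.2 hK.le)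
  have hge : (K⁻¹ * δ) • (1 : B) ≤ K⁻¹ • c := by
    simpa [Algebra.algebraMap_eq_smul_one, smul_smul] using
      smul_le_smul_of_nonneg_left hδc (inv_nonneg.2 hK.le)
  have hbound : 1 - K⁻¹ • c ≤ algebraMap ℝ B (max 0 (1 - K⁻¹ * δ)) :=
    calc 1 - K⁻¹ • c ≤ 1 - (K⁻¹ * δ) • (1 : B) := sub_le_sub_left hge _
      _ = algebraMap ℝ B (1 - K⁻¹ * δ) := by simp [Algebra.algebraMap_eq_smul_one, sub_smul]
      _ ≤ _ := algebraMap_mono B (le_max_right _ _)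
  refine ((CStarAlgebra.norm_le_iff_le_algebraMap _ (le_max_left _ _)
    (sub_nonneg.2 hle)).2 hbound).trans_lt (max_lt one_pos ?_)
  have : 0 < K⁻¹ * δ := by positivity
  linarith

theorem hasSum_apply_log (T : B →L[ℝ] ℝ) {c : B} (hc : IsStrictlyPositive c) {K : ℝ}
    (hK : 0 < K) (h : ‖1 - K⁻¹ • c‖ < 1) :
    HasSum (fun n : ℕ => ((n : ℝ) + 1)⁻¹ * T ((1 - K⁻¹ • c) ^ (n + 1)))
      (Real.log K * T 1 - T (CFC.log c)) := by
  have hcsa : IsSelfAdjoint (K⁻¹ • c) := .smul (.all _) (.of_nonneg hc.nonneg)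
  convert (CFC.hasSum_log_of_norm_one_sub_lt_one hcsa h).mapL T using 1
  · simp
  · rw [CFC.log_smul' c (inv_pos.2 hK) hc]
    simp [Algebra.algebraMap_eq_smul_one]
    ring

theorem apply_log_star_mul_self_add (T : B →L[ℝ] ℝ) (hT : ∀ a b, T (a * b) = T (b * a))
    (x : B) {ε : ℝ} (hε : 0 < ε) :
    T (CFC.log (star x * x + ε • 1)) = T (CFC.log (x * star x + ε • 1)) := by
  have hε1 : IsStrictlyPositive (ε • (1 : B)) := .smul hε isStrictlyPositive_one
  have hu : IsStrictlyPositive (star x * x + ε • 1) := .nonneg_add (star_mul_self_nonneg x) hε1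
  have hv : IsStrictlyPositive (x * star x + ε • 1) := .nonneg_add (mul_star_self_nonneg x) hε1
  obtain ⟨K, hK, hKu, hKv⟩ : ∃ K : ℝ, 0 < K ∧ ‖star x * x + ε • 1‖ ≤ K ∧
      ‖x * star x + ε • 1‖ ≤ K :=
    ⟨‖star x * x + ε • 1‖ + ‖x * star x + ε • 1‖ + 1, by positivity,
      by linarith [norm_nonneg (x * star x + ε • 1)],
      by linarith [norm_nonneg (star x * x + ε • 1)]⟩
  have hsu := hasSum_apply_log T hu hK (hu.norm_one_sub_smul_lt_one hK hKu)
  have hsv := hasSum_apply_log T hv hK (hv.norm_one_sub_smul_lt_one hK hKv)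
  have hpow (n : ℕ) : T ((1 - K⁻¹ • (star x * x + ε • 1)) ^ n) =
      T ((1 - K⁻¹ • (x * star x + ε • 1)) ^ n) := by
    set u := 1 - K⁻¹ • (star x * x + ε • 1)
    set v := 1 - K⁻¹ • (x * star x + ε • 1)
    have hsemi : SemiconjBy x u v := by
      simp only [SemiconjBy, u, v]
      simp [mul_sub, sub_mul, mul_add, add_mul, mul_assoc]
    induction n with
    | zero => simp
    | succ n ih =>
      have hxu : T (star x * x * u ^ n) = T (x * star x * v ^ n) := by
        rw [mul_assoc, (hsemi.pow_right n).eq, hT, hT (x * star x), mul_assoc]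
      have e1 : T (u ^ (n + 1)) = (1 - K⁻¹ * ε) * T (u ^ n) - K⁻¹ * T (star x * x * u ^ n) := by
        rw [pow_succ']
        simp only [u, sub_mul, add_mul, smul_add, smul_mul_assoc, map_sub, map_add, map_smul,
          one_mul, smul_eq_mul]
        ring
      have e2 : T (v ^ (n + 1)) = (1 - K⁻¹ * ε) * T (v ^ n) - K⁻¹ * T (x * star x * v ^ n) := by
        rw [pow_succ']
        simp only [v, sub_mul, add_mul, smul_add, smul_mul_assoc, map_sub, map_add, map_smul,
          one_mul, smul_eq_mul]
        ring
      rw [e1, e2, hxu, ih]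
  simp_rw [hpow] at hsu
  linarith [hsu.unique hsv]

theorem hasDerivAt_apply_log (T : B →L[ℝ] ℝ) (hT : ∀ a b, T (a * b) = T (b * a))
    {c c' : ℝ → B} (hc : ∀ t, IsStrictlyPositive (c t)) (hderiv : ∀ t, HasDerivAt c (c' t) t)
    (hcont : Continuous c') (t : ℝ) :
    HasDerivAt (fun s => T (CFC.log (c s))) (T (Ring.inverse (c t) * c' t)) t := by
  set K : ℝ := ‖c t‖ + 1
  have hK : 0 < K := by positivity
  have hc_cont : Continuous c := continuous_iff_continuousAt.2 fun s => (hderiv s).continuousAt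
  obtain ⟨r, hr, hr1⟩ := exists_between
    ((hc t).norm_one_sub_smul_lt_one hK (le_add_of_nonneg_right zero_le_one))
  have hr0 : 0 ≤ r := (norm_nonneg _).trans hr.le
  set x : ℝ → B := fun s => 1 - K⁻¹ • c s
  set x' : ℝ → B := fun s => -(K⁻¹ • c' s)
  have hx (s : ℝ) : HasDerivAt x (x' s) s := ((hderiv s).const_smul K⁻¹).const_sub 1
  have hx_cont : Continuous x := by fun_prop
  have hx'_cont : Continuous x' := by fun_prop
  obtain ⟨ρ, hρ, hball⟩ : ∃ ρ > 0, ∀ s ∈ Metric.ball t ρ, ‖x s‖ < r ∧ ‖x' s‖ < ‖x' t‖ + 1 := by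
    have h1 : ∀ᶠ s in 𝓝 t, ‖x s‖ < r := hx_cont.norm.continuousAt.eventually_lt_const hr
    have h2 : ∀ᶠ s in 𝓝 t, ‖x' s‖ < ‖x' t‖ + 1 :=
      hx'_cont.norm.continuousAt.eventually_lt_const (lt_add_one _)
    exact Metric.eventually_nhds_iff_ball.1 (h1.and h2)
  have hpow_le (s : ℝ) (hs : s ∈ Metric.ball t ρ) (n : ℕ) :
      ‖x s ^ n * x' s‖ ≤ r ^ n * (‖x' t‖ + 1) := by
    rcases n with _ | n
    · simpa using (hball s hs).2.le
    · refine (norm_mul_le _ _).trans (mul_le_mul ?_ (hball s hs).2.le (norm_nonneg _) (by positivity))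
      exact (norm_pow_le' _ n.succ_pos).trans (pow_le_pow_left₀ (norm_nonneg _) (hball s hs).1.le _)
  have hsum : Summable fun n : ℕ => ‖T‖ * (r ^ n * (‖x' t‖ + 1)) :=
    ((summable_geometric_of_lt_one hr0 hr1).mul_right _).mul_left _
  have hseries (s : ℝ) (hs : s ∈ Metric.ball t ρ) :
      HasSum (fun n : ℕ => ((n : ℝ) + 1)⁻¹ * T (x s ^ (n + 1)))
        (Real.log K * T 1 - T (CFC.log (c s))) :=
    hasSum_apply_log T (hc s) hK ((hball s hs).1.trans hr1)
  have htsum := hasDerivAt_tsum_of_isPreconnected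
    (g := fun (n : ℕ) s => ((n : ℝ) + 1)⁻¹ * T (x s ^ (n + 1)))
    (g' := fun n s => T (x s ^ n * x' s)) hsum Metric.isOpen_ball
    (convex_ball t ρ).isPreconnected
    (fun n s _ => by
      refine ((hasDerivAt_apply_pow T hT (hx s) n).const_mul _).congr_deriv ?_
      field_simp)
    (fun n s hs => (T.le_opNorm _).trans
      (mul_le_mul_of_nonneg_left (hpow_le s hs n) (norm_nonneg _)))
    (Metric.mem_ball_self hρ) (hseries t (Metric.mem_ball_self hρ)).summable
    (Metric.mem_ball_self hρ)
  have hlog : (fun s => T (CFC.log (c s))) =ᶠ[𝓝 t] fun s =>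
      Real.log K * T 1 - ∑' n : ℕ, ((n : ℝ) + 1)⁻¹ * T (x s ^ (n + 1)) := by
    filter_upwards [Metric.ball_mem_nhds t hρ] with s hs
    rw [(hseries s hs).tsum_eq]
    ring
  refine ((htsum.const_sub _).congr_of_eventuallyEq hlog).congr_deriv ?_
  have hxt : ‖x t‖ < 1 := hr.trans hr1
  have hgeom : HasSum (fun n : ℕ => x t ^ n) (Ring.inverse (K⁻¹ • c t)) := by
    have h1 : 1 - x t = K⁻¹ • c t := by simp [x]
    rw [← h1, NormedRing.inverse_one_sub _ hxt]
    exact (summable_geometric_of_norm_lt_one hxt).hasSum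
  rw [((hgeom.mul_right (x' t)).mapL T).tsum_eq, ← map_neg]
  congr 1
  have hu := (hc t).isUnit
  have huK : IsUnit (K⁻¹ • c t) := ((hc t).smul (inv_pos.2 hK)).isUnit
  rw [← mul_neg, neg_neg, Ring.inverse_mul_eq_iff_eq_mul _ _ _ huK, smul_mul_assoc,
    Ring.mul_inverse_cancel_left _ _ hu]

theorem apply_log_conjugate (T : B →L[ℝ] ℝ) (hT : ∀ a b, T (a * b) = T (b * a))
    {y c : B} (hy : IsStrictlyPositive y) (hc : IsStrictlyPositive c) :
    T (CFC.log (y * c * y)) = T (CFC.log c) + 2 * T (CFC.log y) := by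
  set h := CFC.log y
  have hh : IsSelfAdjoint h := .log
  set e : ℝ → B := fun t => NormedSpace.exp (t • h)
  have he (t : ℝ) : HasDerivAt e (h * e t) t := hasDerivAt_exp_smul_const' h t
  have he' (t : ℝ) : HasDerivAt e (e t * h) t := hasDerivAt_exp_smul_const h t
  have hsa (t : ℝ) : IsSelfAdjoint (e t) := ((IsSelfAdjoint.all t).smul hh).exp
  have hpos (t : ℝ) : IsStrictlyPositive (e t * c * e t) := by
    let : NormedAlgebra ℚ B := .restrictScalars ℚ ℝ B
    exact .conjugate_of_isUnit_of_isSelfAdjoint c (e t) (NormedSpace.isUnit_exp _) (hsa t) hc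
  have hderiv (t : ℝ) : HasDerivAt (fun s => e s * c * e s)
      (h * (e t * c * e t) + (e t * c * e t) * h) t := by
    refine (((he t).mul_const c).mul (he' t)).congr_deriv ?_
    simp only [mul_assoc]
  have hcont : Continuous e := continuous_iff_continuousAt.2 fun t => (he t).continuousAt
  have hd (t : ℝ) : HasDerivAt (fun s => T (CFC.log (e s * c * e s)) - s * (2 * T h)) 0 t := by
    refine ((hasDerivAt_apply_log T hT hpos hderiv (by fun_prop) t).sub
      ((hasDerivAt_id t).mul_const _)).congr_deriv ?_
    have hu := (hpos t).isUnit
    rw [mul_add, map_add, hT, mul_assoc h, Ring.mul_inverse_cancel _ hu,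
      Ring.inverse_mul_cancel_left _ _ hu, mul_one]
    ring
  have := is_const_of_deriv_eq_zero (fun t => (hd t).differentiableAt) (fun t => (hd t).deriv) 1 0
  have e0 : e 0 = 1 := by simp [e]
  have e1 : e 1 = y := by simp [e, h, CFC.exp_log y hy]
  simp [e0, e1] at this
  linarith

theorem apply_log_mul_self (T : B →L[ℝ] ℝ) {c : B} (hc : IsStrictlyPositive c) :
    T (CFC.log (c * c)) = 2 * T (CFC.log c) := by
  rw [← pow_two, CFC.log_pow' 2 c hc, two_nsmul, map_add, two_mul]

theorem apply_log_mono (T : B →L[ℝ] ℝ) (hpos : ∀ a, 0 ≤ a → 0 ≤ T a) {c d : B}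
    (hc : IsStrictlyPositive c) (hcd : c ≤ d) : T (CFC.log c) ≤ T (CFC.log d) := by
  have := hpos _ (sub_nonneg.2 (CFC.log_le_log hcd hc))
  rw [map_sub] at this
  linarith

theorem isStrictlyPositive_add_smul_one {c : B} (hc : 0 ≤ c) {ε : ℝ} (hε : 0 < ε) :
    IsStrictlyPositive (c + ε • (1 : B)) :=
  .nonneg_add hc (.smul hε isStrictlyPositive_one)

theorem apply_log_star_mul_self_add_le (T : B →L[ℝ] ℝ) (hT : ∀ a b, T (a * b) = T (b * a))
    (hpos : ∀ a, 0 ≤ a → 0 ≤ T a) (a b : B) {δ η : ℝ} (hδ : 0 < δ) (hη : 0 < η) :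
    T (CFC.log (star (a * b) * (a * b) + (δ * η) • 1)) ≤
      T (CFC.log (star a * a + δ • 1)) + T (CFC.log (star b * b + η • 1)) := by
  have hp : IsStrictlyPositive (star a * a + δ • 1) :=
    isStrictlyPositive_add_smul_one (star_mul_self_nonneg a) hδ
  set p := star a * a + δ • 1
  set s := CFC.sqrt p
  have hs : IsStrictlyPositive s := hp.sqrt
  have hss : s * s = p := CFC.sqrt_mul_sqrt_self p hp.nonneg
  have hssa : star s = s := hs.isSelfAdjoint.star_eq
  have hq : IsStrictlyPositive (b * star b + η • 1) :=
    isStrictlyPositive_add_smul_one (mul_star_self_nonneg b) hη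
  have hδη : 0 < δ * η := mul_pos hδ hη
  have hle1 : star (a * b) * (a * b) ≤ star (s * b) * (s * b) := by
    have h1 : star a * a ≤ p := le_add_of_nonneg_right (smul_nonneg hδ.le zero_le_one)
    calc star (a * b) * (a * b) = star b * (star a * a) * b := by simp [mul_assoc]
      _ ≤ star b * p * b := star_left_conjugate_le_conjugate h1 b
      _ = star (s * b) * (s * b) := by rw [← hss, star_mul, hssa]; simp only [mul_assoc]
  have hle2 : s * b * star (s * b) + (δ * η) • 1 ≤ s * (b * star b + η • 1) * s := by
    have h1 : δ • (1 : B) ≤ p := le_add_of_nonneg_left (star_mul_self_nonneg a)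
    calc s * b * star (s * b) + (δ * η) • 1 = s * (b * star b) * s + η • δ • (1 : B) := by
          rw [star_mul, hssa, smul_smul, mul_comm η]; simp only [mul_assoc]
      _ ≤ s * (b * star b) * s + η • p := by gcongr
      _ = s * (b * star b + η • 1) * s := by simp [mul_add, add_mul, hss]
  calc T (CFC.log (star (a * b) * (a * b) + (δ * η) • 1))
      ≤ T (CFC.log (star (s * b) * (s * b) + (δ * η) • 1)) :=
        apply_log_mono T hpos (isStrictlyPositive_add_smul_one (star_mul_self_nonneg _) hδη)
          (by gcongr)
    _ = T (CFC.log (s * b * star (s * b) + (δ * η) • 1)) := apply_log_star_mul_self_add T hT _ hδη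
    _ ≤ T (CFC.log (s * (b * star b + η • 1) * s)) :=
        apply_log_mono T hpos (isStrictlyPositive_add_smul_one (mul_star_self_nonneg _) hδη) hle2
    _ = T (CFC.log p) + T (CFC.log (star b * b + η • 1)) := by
        rw [apply_log_conjugate T hT hs hq, ← apply_log_star_mul_self_add T hT b hη, ← hss,
          apply_log_mul_self T hs, add_comm]

theorem exists_add_le_apply_log_star_mul_self (T : B →L[ℝ] ℝ)
    (hT : ∀ a b, T (a * b) = T (b * a)) (hpos : ∀ a, 0 ≤ a → 0 ≤ T a) (a b : B) {ε : ℝ}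
    (hε : 0 < ε) :
    ∃ δ > (0 : ℝ), ∃ η > (0 : ℝ),
      T (CFC.log (star a * a + δ • 1)) + T (CFC.log (star b * b + η • 1)) ≤
        T (CFC.log (star (a * b) * (a * b) + ε • 1)) := by
  obtain ⟨δ, hδ, hδb⟩ : ∃ δ > (0 : ℝ), δ * ‖b‖ ^ 2 ≤ ε / 2 :=
    ⟨ε / 2 / (‖b‖ ^ 2 + 1), by positivity, by
      rw [div_mul_eq_mul_div, div_le_iff₀ (by positivity)]
      nlinarith⟩
  have hp : IsStrictlyPositive (star a * a + δ • 1) :=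
    isStrictlyPositive_add_smul_one (star_mul_self_nonneg a) hδ
  set p := star a * a + δ • 1 with hp_def
  obtain ⟨η, hη, hηp⟩ : ∃ η > (0 : ℝ), η * ‖p‖ ≤ ε / 2 :=
    ⟨ε / 2 / (‖p‖ + 1), by positivity, by
      rw [div_mul_eq_mul_div, div_le_iff₀ (by positivity)]
      nlinarith⟩
  refine ⟨δ, hδ, η, hη, ?_⟩
  set s := CFC.sqrt p
  have hs : IsStrictlyPositive s := hp.sqrt
  have hss : s * s = p := CFC.sqrt_mul_sqrt_self p hp.nonneg
  have hssa : star s = s := hs.isSelfAdjoint.star_eq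
  have hq : IsStrictlyPositive (b * star b + η • 1) :=
    isStrictlyPositive_add_smul_one (mul_star_self_nonneg b) hη
  have hε2 : 0 < ε / 2 := half_pos hε
  have hle1 : star (s * b) * (s * b) + (ε / 2) • 1 ≤ star (a * b) * (a * b) + ε • 1 := by
    have hb : δ • (star b * b) ≤ (ε / 2) • (1 : B) :=
      calc δ • (star b * b) ≤ δ • algebraMap ℝ B (‖b‖ ^ 2) :=
            smul_le_smul_of_nonneg_left CStarAlgebra.star_mul_le_algebraMap_norm_sq hδ.le
        _ = (δ * ‖b‖ ^ 2) • (1 : B) := by rw [Algebra.algebraMap_eq_smul_one, smul_smul]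
        _ ≤ (ε / 2) • (1 : B) := smul_le_smul_of_nonneg_right hδb zero_le_one
    calc star (s * b) * (s * b) + (ε / 2) • 1
        = star (a * b) * (a * b) + δ • (star b * b) + (ε / 2) • 1 := by
          have : star (s * b) * (s * b) = star b * p * b := by
            rw [← hss, star_mul, hssa]; simp only [mul_assoc]
          rw [this, hp_def]
          simp [mul_add, add_mul, mul_assoc]
      _ ≤ star (a * b) * (a * b) + (ε / 2) • 1 + (ε / 2) • 1 := by gcongr
      _ = star (a * b) * (a * b) + ε • 1 := by rw [add_assoc, ← add_smul, add_halves]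
  have hle2 : s * (b * star b + η • 1) * s ≤ s * b * star (s * b) + (ε / 2) • 1 := by
    have h1 : η • p ≤ (ε / 2) • (1 : B) :=
      calc η • p ≤ η • algebraMap ℝ B ‖p‖ :=
            smul_le_smul_of_nonneg_left hp.isSelfAdjoint.le_algebraMap_norm_self hη.le
        _ = (η * ‖p‖) • (1 : B) := by rw [Algebra.algebraMap_eq_smul_one, smul_smul]
        _ ≤ (ε / 2) • (1 : B) := smul_le_smul_of_nonneg_right hηp zero_le_one
    calc s * (b * star b + η • 1) * s = s * b * star (s * b) + η • p := by
          rw [star_mul, hssa]; simp [mul_add, add_mul, hss, mul_assoc]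
      _ ≤ _ := by gcongr
  calc T (CFC.log p) + T (CFC.log (star b * b + η • 1))
      = T (CFC.log (s * (b * star b + η • 1) * s)) := by
        rw [apply_log_conjugate T hT hs hq, ← apply_log_star_mul_self_add T hT b hη, ← hss,
          apply_log_mul_self T hs, add_comm]
    _ ≤ T (CFC.log (s * b * star (s * b) + (ε / 2) • 1)) :=
        apply_log_mono T hpos
          (.conjugate_of_isUnit_of_isSelfAdjoint _ s hs.isUnit hs.isSelfAdjoint hq) hle2
    _ = T (CFC.log (star (s * b) * (s * b) + (ε / 2) • 1)) :=
        (apply_log_star_mul_self_add T hT _ hε2).symm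
    _ ≤ _ := apply_log_mono T hpos
        (isStrictlyPositive_add_smul_one (star_mul_self_nonneg _) hε2) hle1

theorem cstarAbs_nonneg (a : B) : 0 ≤ cstarAbs a := CFC.sqrt_nonneg _

theorem cstarAbs_mul_self (a : B) : cstarAbs a * cstarAbs a = star a * a :=
  CFC.sqrt_mul_sqrt_self _ (star_mul_self_nonneg a)

theorem fkDet_nonneg (τ : B →ₗ[ℂ] ℂ) (a : B) : 0 ≤ fkDet τ a :=
  Real.iInf_nonneg fun _ => (Real.exp_pos _).le

theorem isGLB_fkDet (τ : B →ₗ[ℂ] ℂ) (T : B →L[ℝ] ℝ) (hτT : ∀ a, (τ a).re = T a)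
    (hpos : ∀ a, 0 ≤ a → 0 ≤ T a) (a : B) :
    IsGLB (Set.range fun ε : {ε : ℝ // 0 < ε} =>
      Real.exp (T (CFC.log (star a * a + (ε : ℝ) • 1)) / 2)) (fkDet τ a) := by
  have hsp {ε : ℝ} (hε : 0 < ε) : IsStrictlyPositive (cstarAbs a + ε • (1 : B)) :=
    isStrictlyPositive_add_smul_one (cstarAbs_nonneg a) hε
  have hsq (ε : ℝ) : (cstarAbs a + ε • (1 : B)) * (cstarAbs a + ε • 1) =
      star a * a + (2 * ε) • cstarAbs a + (ε * ε) • 1 := by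
    rw [← cstarAbs_mul_self]
    simp only [mul_add, add_mul, mul_smul_comm, smul_mul_assoc, mul_one, one_mul]
    module
  have hexp (ε : ℝ) (hε : 0 < ε) : Real.exp ((τ (CFC.log (cstarAbs a + ε • 1))).re) =
      Real.exp (T (CFC.log (star a * a + (2 * ε) • cstarAbs a + (ε * ε) • 1)) / 2) := by
    rw [hτT, ← hsq, apply_log_mul_self T (hsp hε), mul_div_cancel_left₀ _ two_ne_zero]
  have hbdd : BddBelow (Set.range fun ε : {ε : ℝ // 0 < ε} =>
      Real.exp ((τ (CFC.log (cstarAbs a + (ε : ℝ) • 1))).re)) :=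
    ⟨0, by rintro _ ⟨ε, rfl⟩; exact (Real.exp_pos _).le⟩
  constructor
  · rintro _ ⟨⟨ε, hε⟩, rfl⟩
    obtain ⟨e, he, hle⟩ : ∃ e > (0 : ℝ), 2 * e * ‖cstarAbs a‖ + e * e ≤ ε := by
      have hlim : Tendsto (fun e : ℝ => 2 * e * ‖cstarAbs a‖ + e * e) (𝓝[>] 0) (𝓝 0) := by
        have : Continuous fun e : ℝ => 2 * e * ‖cstarAbs a‖ + e * e := by fun_prop
        simpa using (this.tendsto 0).mono_left nhdsWithin_le_nhds
      obtain ⟨e, h1, h2⟩ := ((hlim.eventually_le_const hε).and self_mem_nhdsWithin).exists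
      exact ⟨e, h2, h1⟩
    refine (ciInf_le hbdd ⟨e, he⟩).trans ?_
    dsimp only
    rw [hexp e he, ← hsq]
    gcongr
    have hsp_sq : IsStrictlyPositive ((cstarAbs a + e • (1 : B)) * (cstarAbs a + e • 1)) := by
      simpa using IsStrictlyPositive.conjugate_of_isUnit_of_isSelfAdjoint 1 _ (hsp he).isUnit
        (hsp he).isSelfAdjoint isStrictlyPositive_one
    refine apply_log_mono T hpos hsp_sq ?_
    rw [hsq]
    calc star a * a + (2 * e) • cstarAbs a + (e * e) • 1
        ≤ star a * a + (2 * e) • algebraMap ℝ B ‖cstarAbs a‖ + (e * e) • 1 := by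
          gcongr
          exact (IsSelfAdjoint.of_nonneg (cstarAbs_nonneg a)).le_algebraMap_norm_self
      _ = star a * a + (2 * e * ‖cstarAbs a‖ + e * e) • 1 := by
          rw [Algebra.algebraMap_eq_smul_one, smul_smul, add_smul, add_assoc]
      _ ≤ star a * a + ε • 1 := by gcongr
  · intro m hm
    have : Nonempty {ε : ℝ // 0 < ε} := ⟨⟨1, one_pos⟩⟩
    refine le_ciInf fun ⟨ε, hε⟩ => (hm ⟨⟨ε * ε, mul_pos hε hε⟩, rfl⟩).trans ?_
    dsimp only
    rw [hexp ε hε]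
    gcongr
    refine apply_log_mono T hpos
      (isStrictlyPositive_add_smul_one (star_mul_self_nonneg a) (mul_pos hε hε)) ?_
    gcongr
    exact le_add_of_nonneg_right (smul_nonneg (by positivity) (cstarAbs_nonneg a))

/-- The real part of a positive linear functional, as a continuous real linear functional. -/
noncomputable def rePositiveFunctional (τ : B →ₗ[ℂ] ℂ) (hτ : ∀ a : B, 0 ≤ a → 0 ≤ τ a) :
    B →L[ℝ] ℝ :=
  Complex.reCLM.comp
    ⟨τ.restrictScalars ℝ, map_continuous (PositiveLinearMap.mk₀ τ hτ)⟩

theorem rePositiveFunctional_apply (τ : B →ₗ[ℂ] ℂ) (hτ : ∀ a : B, 0 ≤ a → 0 ≤ τ a) (a : B) :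
    rePositiveFunctional τ hτ a = (τ a).re := rfl

end

/-- The Fuglede–Kadison determinant associated to a tracial state `τ` on a
unital C*-algebra is multiplicative: `Δ_τ(ab) = Δ_τ(a)·Δ_τ(b)`. -/
theorem fkDet_mul
    {B : Type*} [CStarAlgebra B] [PartialOrder B] [StarOrderedRing B]
    (τ : B →ₗ[ℂ] ℂ)
    (hτ1 : τ 1 = 1)
    (hτpos : ∀ a : B, 0 ≤ a → 0 ≤ τ a)
    (hτtr : ∀ a b : B, τ (a * b) = τ (b * a))
    (a b : B) :
    fkDet τ (a * b) = fkDet τ a * fkDet τ b := by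
  set T := rePositiveFunctional τ hτpos
  have hT : ∀ x y, T (x * y) = T (y * x) := fun x y => by
    simp only [T, rePositiveFunctional_apply, hτtr x y]
  have hpos : ∀ x, 0 ≤ x → 0 ≤ T x := fun x hx => (Complex.nonneg_iff.1 (hτpos x hx)).1
  have hglb := isGLB_fkDet τ T (fun _ => rfl) hpos
  apply le_antisymm
  · have hle (δ η : {ε : ℝ // 0 < ε}) : fkDet τ (a * b) ≤
        Real.exp (T (CFC.log (star a * a + (δ : ℝ) • 1)) / 2) *
          Real.exp (T (CFC.log (star b * b + (η : ℝ) • 1)) / 2) := by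
      refine ((hglb (a * b)).1 ⟨⟨δ * η, mul_pos δ.2 η.2⟩, rfl⟩).trans ?_
      rw [← Real.exp_add, ← add_div]
      exact Real.exp_le_exp.2 (div_le_div_of_nonneg_right
        (apply_log_star_mul_self_add_le T hT hpos a b δ.2 η.2) two_pos.le)
    have : Nonempty {ε : ℝ // 0 < ε} := ⟨⟨1, one_pos⟩⟩
    rw [← (hglb a).csInf_eq (Set.range_nonempty _), ← (hglb b).csInf_eq (Set.range_nonempty _),
      sInf_range, sInf_range,
      Real.iInf_mul_of_nonneg (Real.iInf_nonneg fun _ => (Real.exp_pos _).le)]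
    refine le_ciInf fun δ => ?_
    rw [Real.mul_iInf_of_nonneg (Real.exp_pos _).le]
    exact le_ciInf fun η => hle δ η
  · refine (hglb (a * b)).2 ?_
    rintro _ ⟨⟨ε, hε⟩, rfl⟩
    obtain ⟨δ, hδ, η, hη, h⟩ := exists_add_le_apply_log_star_mul_self T hT hpos a b hε
    calc fkDet τ a * fkDet τ b
        ≤ Real.exp (T (CFC.log (star a * a + δ • 1)) / 2) *
            Real.exp (T (CFC.log (star b * b + η • 1)) / 2) :=
          mul_le_mul ((hglb a).1 ⟨⟨δ, hδ⟩, rfl⟩) ((hglb b).1 ⟨⟨η, hη⟩, rfl⟩) (fkDet_nonneg τ b)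
            (Real.exp_pos _).le
      _ ≤ _ := by
          rw [← Real.exp_add, ← add_div]
          exact Real.exp_le_exp.2 (div_le_div_of_nonneg_right h two_pos.le)
end

section
/- Let M be a unital C*-algebra with a tracial state τ, and let Δ_τ be the associated Fuglede–Kadison determinant. If x ∈ M satisfies r(x) ≤ 1 and τ(x^m) = 0 for every integer m ≥ 1, then Δ_τ(1 + x) = 1. Equivalently, if a ∈ M satisfies r(1 − a) ≤ 1 and τ(a^m) = 1 for every integer m ≥ 1, then Δ_τ(a) = 1. -/
open scoped ComplexOrder

section

open Set Filter Topology
open scoped Ring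

variable {M : Type*} [CStarAlgebra M]

/-- The Mercator series for `log (1 - y)` with `y` selfadjoint of norm less than one. -/
lemma IsSelfAdjoint.hasSum_log_one_sub [Nontrivial M] {y : M} (hy : IsSelfAdjoint y) (h : ‖y‖ < 1) :
    HasSum (fun n : ℕ ↦ ((n : ℝ) + 1)⁻¹ • y ^ (n + 1)) (-CFC.log (1 - y)) := by
  have hspec : ∀ t ∈ spectrum ℝ y, |t| ≤ ‖y‖ := fun t ht ↦ spectrum.norm_le_norm_of_mem ht
  have hlog : ContinuousOn (fun t : ℝ ↦ Real.log (1 - t)) (spectrum ℝ y) :=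
    ContinuousOn.log (by fun_prop) fun t ht ↦ by
      have := (abs_le.1 (hspec t ht)).2
      linarith
  have hcfc : ∀ n : ℕ, ∑ i ∈ Finset.range n, ((i : ℝ) + 1)⁻¹ • y ^ (i + 1) + CFC.log (1 - y) =
      cfc (fun t : ℝ ↦ ∑ i ∈ Finset.range n, t ^ (i + 1) / (i + 1) + Real.log (1 - t)) y := by
    intro n
    have hsum : cfc (fun t : ℝ ↦ ∑ i ∈ Finset.range n, t ^ (i + 1) / (i + 1)) y =
        ∑ i ∈ Finset.range n, ((i : ℝ) + 1)⁻¹ • y ^ (i + 1) := by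
      have : (fun t : ℝ ↦ ∑ i ∈ Finset.range n, t ^ (i + 1) / (i + 1)) =
          ∑ i ∈ Finset.range n, fun t : ℝ ↦ ((i : ℝ) + 1)⁻¹ • t ^ (i + 1) := by
        ext t
        simp [div_eq_inv_mul]
      rw [this, cfc_sum ..]
      refine Finset.sum_congr rfl fun i _ ↦ ?_
      rw [cfc_smul .., cfc_pow_id ..]
    have hlog' : cfc (fun t : ℝ ↦ Real.log (1 - t)) y = CFC.log (1 - y) := by
      have himage : ContinuousOn Real.log ((fun t : ℝ ↦ 1 - t) '' spectrum ℝ y) :=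
        ContinuousOn.log continuousOn_id <| by
          rintro _ ⟨t, ht, rfl⟩
          have := (abs_le.1 (hspec t ht)).2
          exact (sub_pos.2 (this.trans_lt h)).ne'
      rw [cfc_comp' Real.log (fun t : ℝ ↦ 1 - t) y himage, cfc_sub ..,
        cfc_const_one .., cfc_id' .., CFC.log]
    rw [cfc_add .., hsum, hlog']
  have hsum : Summable fun n : ℕ ↦ ((n : ℝ) + 1)⁻¹ • y ^ (n + 1) := by
    refine Summable.of_norm_bounded (summable_geometric_of_lt_one (norm_nonneg y) h) fun n ↦ ?_
    rw [norm_smul, norm_inv, Real.norm_of_nonneg (by positivity : (0 : ℝ) ≤ n + 1)]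
    refine (mul_le_of_le_one_left (norm_nonneg _) (inv_le_one_of_one_le₀ (by simp))).trans ?_
    exact (norm_pow_le y _).trans (pow_le_pow_of_le_one (norm_nonneg y) h.le n.le_succ)
  rw [hsum.hasSum_iff_tendsto_nat, tendsto_iff_norm_sub_tendsto_zero]
  have hlim : Tendsto (fun n : ℕ ↦ ‖y‖ ^ (n + 1) / (1 - ‖y‖)) atTop (𝓝 0) := by
    simpa using ((tendsto_pow_atTop_nhds_zero_of_lt_one (norm_nonneg y) h).comp
      (tendsto_add_atTop_nat 1)).div_const (1 - ‖y‖)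
  refine squeeze_zero (fun _ ↦ norm_nonneg _) (fun n ↦ ?_) hlim
  rw [sub_neg_eq_add, hcfc]
  have hpos : 0 < 1 - ‖y‖ := sub_pos.2 h
  refine norm_cfc_le (by positivity) fun t ht ↦ ?_
  have ht' := hspec t ht
  refine (Real.abs_log_sub_add_sum_range_le (ht'.trans_lt h) n).trans ?_
  gcongr

/-- Differentiability of `t ↦ σ (log (1 - y t))` for a bounded trace `σ`. -/
lemma hasDerivAt_trace_log_one_sub [Nontrivial M] (σ : M →L[ℝ] ℝ) (hσ : ∀ a b, σ (a * b) = σ (b * a))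
    {y y' : ℝ → M} (hy : ∀ t, HasDerivAt y (y' t) t) (hy' : Continuous y')
    (hsa : ∀ t, IsSelfAdjoint (y t)) {t₀ : ℝ} (h : ‖y t₀‖ < 1) :
    HasDerivAt (fun t ↦ σ (CFC.log (1 - y t))) (-σ ((1 - y t₀)⁻¹ʳ * y' t₀)) t₀ := by
  have hyc : Continuous y := continuous_iff_continuousAt.2 fun t ↦ (hy t).continuousAt
  obtain ⟨q, hq, hq1⟩ := exists_between h
  obtain ⟨C, hC⟩ := exists_gt ‖y' t₀‖
  have hq0 : 0 ≤ q := (norm_nonneg _).trans hq.le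
  have hev : ∀ᶠ t in 𝓝 t₀, ‖y t‖ < q ∧ ‖y' t‖ < C :=
    (hyc.norm.continuousAt.eventually_lt_const hq).and
      (hy'.norm.continuousAt.eventually_lt_const hC)
  obtain ⟨δ, hδ, hball⟩ := Metric.eventually_nhds_iff_ball.1 hev
  have ht₀ : t₀ ∈ Metric.ball t₀ δ := Metric.mem_ball_self hδ
  have hsum : ∀ t ∈ Metric.ball t₀ δ, HasSum (fun n : ℕ ↦ σ (((n : ℝ) + 1)⁻¹ • y t ^ (n + 1)))
      (-σ (CFC.log (1 - y t))) := fun t ht ↦ by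
    simpa using ((hsa t).hasSum_log_one_sub ((hball t ht).1.trans hq1)).mapL σ
  have hder : ∀ (n : ℕ) (t : ℝ), HasDerivAt (fun t ↦ σ (((n : ℝ) + 1)⁻¹ • y t ^ (n + 1)))
      (σ (y t ^ n * y' t)) t := by
    intro n t
    have h1 := σ.hasFDerivAt.comp_hasDerivAt t
      (((hy t).fun_pow' (n + 1)).const_smul ((n : ℝ) + 1)⁻¹)
    convert! h1 using 1
    rw [map_smul, map_sum, Finset.sum_congr rfl (g := fun _ ↦ σ (y t ^ n * y' t))]
    · simp only [Finset.sum_const, Finset.card_range, nsmul_eq_mul, smul_eq_mul]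
      push_cast
      field_simp
    · intro i hi
      rw [hσ, ← mul_assoc, ← pow_add]
      congr 3
      have := Finset.mem_range.1 hi
      simp only [Nat.pred_eq_sub_one]
      omega
  have hbound : ∀ (n : ℕ), ∀ t ∈ Metric.ball t₀ δ,
      ‖σ (y t ^ n * y' t)‖ ≤ q ^ n * (‖σ‖ * C) := by
    intro n t ht
    obtain ⟨h1, h2⟩ := hball t ht
    calc ‖σ (y t ^ n * y' t)‖ ≤ ‖σ‖ * ‖y t ^ n * y' t‖ := σ.le_opNorm _
      _ ≤ ‖σ‖ * (‖y t‖ ^ n * ‖y' t‖) := by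
        gcongr
        refine (norm_mul_le _ _).trans ?_
        gcongr
        exact norm_pow_le _ _
      _ ≤ ‖σ‖ * (q ^ n * C) := by gcongr
      _ = _ := by ring
  have key := hasDerivAt_tsum_of_isPreconnected
    ((summable_geometric_of_lt_one hq0 hq1).mul_right _) Metric.isOpen_ball
    (convex_ball t₀ δ).isPreconnected (fun n t _ ↦ hder n t) hbound ht₀ (hsum t₀ ht₀).summable ht₀
  have hval : ∑' n : ℕ, σ (y t₀ ^ n * y' t₀) = σ ((1 - y t₀)⁻¹ʳ * y' t₀) :=
    (((hasSum_geom_series_inverse (y t₀) h).mul_right (y' t₀)).mapL σ).tsum_eq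
  rw [hval] at key
  refine key.neg.congr_of_eventuallyEq ?_
  filter_upwards [Metric.ball_mem_nhds t₀ hδ] with t ht
  simp only [Pi.neg_apply]
  rw [(hsum t ht).tsum_eq, neg_neg]

lemma CFC.log_eq_log_add_log_one_sub {p : M} {N : ℝ} (hN : 0 < N) (hp : IsSelfAdjoint p)
    (h : ‖1 - N⁻¹ • p‖ < 1) :
    CFC.log p = algebraMap ℝ M (Real.log N) + CFC.log (1 - (1 - N⁻¹ • p)) := by
  have hu := isUnit_one_sub_of_norm_lt_one h
  have : p = N • (1 - (1 - N⁻¹ • p)) := by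
    rw [sub_sub_cancel, smul_smul, mul_inv_cancel₀ hN.ne', one_smul]
  conv_lhs => rw [this]
  refine CFC.log_smul _ (fun t ht ht0 ↦ ?_) hN.ne' ?_
  · rw [ht0] at ht
    exact spectrum.zero_notMem _ hu ht
  · rw [sub_sub_cancel]
    exact (IsSelfAdjoint.all N⁻¹).smul hp

/-- If the spectral radius of `x` is at most one, its powers grow subexponentially. -/
lemma eventually_norm_pow_lt_of_spectralRadius_le_one {x : M} (hx : spectralRadius ℂ x ≤ 1) {s : ℝ}
    (hs : 1 < s) : ∀ᶠ n : ℕ in atTop, ‖x ^ n‖ < s ^ n := by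
  have h := spectrum.pow_norm_pow_one_div_tendsto_nhds_spectralRadius x
  have hs' : spectralRadius ℂ x < ENNReal.ofReal s :=
    hx.trans_lt (by simpa using hs)
  filter_upwards [h.eventually_lt_const hs', eventually_gt_atTop 0] with n hn hn0
  have h1 : ‖x ^ n‖ ^ (1 / n : ℝ) < s := (ENNReal.ofReal_lt_ofReal_iff (by linarith)).1 hn
  rwa [one_div, Real.rpow_inv_lt_iff_of_pos (norm_nonneg _) (by linarith) (by positivity),
    Real.rpow_natCast] at h1

lemma tendsto_smul_pow_of_spectralRadius_le_one {x : M} (hx : spectralRadius ℂ x ≤ 1) {r : ℝ}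
    (hr0 : 0 ≤ r) (hr : r < 1) : Tendsto (fun n : ℕ ↦ (r • x) ^ n) atTop (𝓝 0) := by
  obtain ⟨s, hs, hs'⟩ : ∃ s : ℝ, 1 < s ∧ r * s < 1 := by
    refine ⟨2 / (1 + r), ?_, ?_⟩
    · rw [lt_div_iff₀ (by linarith)]; linarith
    · rw [mul_div_assoc', div_lt_one (by linarith)]; linarith
  refine squeeze_zero_norm' ?_ (tendsto_pow_atTop_nhds_zero_of_lt_one (by positivity) hs')
  filter_upwards [eventually_norm_pow_lt_of_spectralRadius_le_one hx hs] with n hn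
  rw [smul_pow, norm_smul, norm_pow, Real.norm_of_nonneg hr0, mul_pow]
  gcongr

lemma tendsto_neg_pow_of_tendsto_pow {z : M} (hz : Tendsto (fun n : ℕ ↦ z ^ n) atTop (𝓝 0)) :
    Tendsto (fun n : ℕ ↦ (-z) ^ n) atTop (𝓝 0) := by
  rw [tendsto_zero_iff_norm_tendsto_zero] at hz ⊢
  refine hz.congr fun n ↦ ?_
  rcases n.even_or_odd with h | h <;> simp [h.neg_pow]

lemma isUnit_one_add_of_tendsto_pow {z : M} (hz : Tendsto (fun n : ℕ ↦ z ^ n) atTop (𝓝 0)) :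
    IsUnit (1 + z) := by
  obtain ⟨n, hn⟩ := ((tendsto_neg_pow_of_tendsto_pow hz).norm.eventually_lt_const
    (by simp : ‖(0 : M)‖ < 1)).exists
  have hu : IsUnit (1 - (-z) ^ n) := isUnit_one_sub_of_norm_lt_one hn
  rw [← mul_neg_geom_sum, sub_neg_eq_add] at hu
  refine (Commute.isUnit_mul_iff ?_).1 hu |>.1
  exact Commute.sum_right _ _ _ fun i _ ↦ ((Commute.one_left _).add_left
    ((Commute.refl z).neg_right)).pow_right i

lemma map_inverse_one_add_mul_eq_zero {σ : M →L[ℝ] ℝ} {y : M} {t : ℝ}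
    (hz : Tendsto (fun n : ℕ ↦ (t • y) ^ n) atTop (𝓝 0)) (hm : ∀ m : ℕ, 1 ≤ m → σ (y ^ m) = 0) :
    σ ((1 + t • y)⁻¹ʳ * y) = 0 := by
  have hu := isUnit_one_add_of_tendsto_pow hz
  have hsum : ∀ n : ℕ, σ ((1 + t • y)⁻¹ʳ * (-(t • y)) ^ n * y) = σ ((1 + t • y)⁻¹ʳ * y) := by
    intro n
    induction n with
    | zero => simp
    | succ n ih =>
      have h1 : (1 + t • y)⁻¹ʳ * (-(t • y)) ^ (n + 1) =
          (1 + t • y)⁻¹ʳ * (-(t • y)) ^ n - (-(t • y)) ^ n := by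
        have h2 : (-(t • y)) ^ (n + 1) =
            (-(t • y)) ^ n - (1 + t • y) * (-(t • y)) ^ n := by
          rw [pow_succ', add_mul, one_mul, sub_add_cancel_left, neg_mul]
        rw [h2, mul_sub, Ring.inverse_mul_cancel_left _ _ hu]
      rw [h1, sub_mul, map_sub, ih, sub_eq_self, ← neg_smul, smul_pow, smul_mul_assoc,
        ← pow_succ, map_smul, hm _ (by simp), smul_zero]
  have hlim : Tendsto (fun n : ℕ ↦ σ ((1 + t • y)⁻¹ʳ * (-(t • y)) ^ n * y)) atTop (𝓝 0) := by
    have := (σ.continuous.tendsto _).comp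
      (((tendsto_neg_pow_of_tendsto_pow hz).const_mul (1 + t • y)⁻¹ʳ).mul_const y)
    simpa [Function.comp_def] using this
  simp only [hsum] at hlim
  exact (tendsto_const_nhds_iff.1 hlim)

lemma map_mul_pow_comm {σ : M →L[ℝ] ℝ} (hσ : ∀ a b, σ (a * b) = σ (b * a)) (a b : M) (n : ℕ) :
    σ ((a * b) ^ (n + 1)) = σ ((b * a) ^ (n + 1)) := by
  rw [pow_succ, ← mul_assoc, mul_pow_mul, hσ, ← mul_assoc, ← pow_succ']

lemma map_aeval_mul_comm {σ : M →L[ℝ] ℝ} (hσ : ∀ a b, σ (a * b) = σ (b * a)) (a b : M)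
    (q : Polynomial ℝ) : σ (Polynomial.aeval (a * b) q) = σ (Polynomial.aeval (b * a) q) := by
  induction q using Polynomial.induction_on with
  | C r => simp
  | add p q hp hq => simp [hp, hq]
  | monomial n r _ => simp [← Algebra.smul_def, map_mul_pow_comm hσ a b]

variable [PartialOrder M] [StarOrderedRing M]

lemma norm_one_sub_smul_lt_one [Nontrivial M] {p : M} {c N : ℝ} (hc : 0 < c) (hN : 0 < N)
    (hcp : algebraMap ℝ M c ≤ p) (hpN : p ≤ algebraMap ℝ M N) : ‖1 - N⁻¹ • p‖ < 1 := by
  have h0 : 0 ≤ 1 - N⁻¹ • p := by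
    have := smul_le_smul_of_nonneg_left hpN (inv_nonneg.2 hN.le)
    rw [Algebra.algebraMap_eq_smul_one, smul_smul, inv_mul_cancel₀ hN.ne', one_smul] at this
    exact sub_nonneg.2 this
  have h1 : 1 - N⁻¹ • p ≤ algebraMap ℝ M (1 - N⁻¹ * c) := by
    have := smul_le_smul_of_nonneg_left hcp (inv_nonneg.2 hN.le)
    rw [Algebra.algebraMap_eq_smul_one, smul_smul] at this
    rw [map_sub, map_one, Algebra.algebraMap_eq_smul_one]
    exact sub_le_sub_left this 1
  have h2 : ‖1 - N⁻¹ • p‖ ≤ ‖algebraMap ℝ M (1 - N⁻¹ * c)‖ :=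
    CStarAlgebra.norm_le_norm_of_nonneg_of_le h0 h1
  have hcN : c ≤ N := by
    have := hcp.trans hpN
    rwa [algebraMap_le_algebraMap] at this
  have : N⁻¹ * c ≤ 1 := by rwa [inv_mul_le_iff₀ hN, mul_one]
  have : 0 < N⁻¹ * c := by positivity
  rw [norm_algebraMap', Real.norm_of_nonneg (by linarith)] at h2
  linarith

lemma IsStrictlyPositive.exists_algebraMap_le [Nontrivial M] {p : M} (hp : IsStrictlyPositive p) :
    ∃ c : ℝ, 0 < c ∧ algebraMap ℝ M c ≤ p := by
  obtain ⟨c, hc, h⟩ := (CFC.exists_pos_algebraMap_le_iff (IsSelfAdjoint.of_nonneg hp.nonneg)).2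
    ((StarOrderedRing.isStrictlyPositive_iff_spectrum_pos p).1 hp)
  exact ⟨c, hc, h⟩

/-- An operator of spectral radius at most one is, up to a factor `s > 1`, a contraction for an
equivalent weight. -/
lemma exists_one_le_star_mul_mul_le {x : M} (hx : spectralRadius ℂ x ≤ 1) {s : ℝ} (hs : 1 < s) :
    ∃ k : M, 1 ≤ k ∧ star x * k * x ≤ s ^ 2 • k := by
  have hs0 : 0 < s := by linarith
  obtain ⟨n, hn, hn0⟩ := ((eventually_norm_pow_lt_of_spectralRadius_le_one hx hs).and
    (eventually_gt_atTop 0)).exists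
  obtain ⟨n, rfl⟩ := Nat.exists_eq_add_one_of_ne_zero hn0.ne'
  set f : ℕ → M := fun j ↦ ((s ^ 2)⁻¹) ^ j • (star (x ^ j) * x ^ j)
  have hf0 : f 0 = 1 := by simp [f]
  have hf : ∀ j, 0 ≤ f j := fun j ↦ smul_nonneg (by positivity) (star_mul_self_nonneg _)
  have hfn : f (n + 1) ≤ 1 := by
    have h1 : star (x ^ (n + 1)) * x ^ (n + 1) ≤ algebraMap ℝ M ((s ^ 2) ^ (n + 1)) := by
      refine CStarAlgebra.star_mul_le_algebraMap_norm_sq.trans (algebraMap_mono M ?_)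
      rw [← pow_mul, mul_comm, pow_mul]
      gcongr
    refine (smul_le_smul_of_nonneg_left h1 (by positivity)).trans_eq ?_
    rw [Algebra.algebraMap_eq_smul_one, smul_smul, ← mul_pow, inv_mul_cancel₀ (by positivity),
      one_pow, one_smul]
  have hshift : ∀ j, star x * f j * x = s ^ 2 • f (j + 1) := fun j ↦ by
    simp only [f]
    rw [smul_smul, pow_succ (s ^ 2)⁻¹, mul_left_comm, mul_inv_cancel₀ (by positivity), mul_one,
      pow_succ x, star_mul]
    simp only [mul_smul_comm, smul_mul_assoc, mul_assoc]
  refine ⟨∑ j ∈ Finset.range (n + 1), f j, ?_, ?_⟩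
  · rw [Finset.sum_range_succ', hf0]
    exact le_add_of_nonneg_left (Finset.sum_nonneg fun j _ ↦ hf _)
  · rw [Finset.mul_sum, Finset.sum_mul, Finset.sum_congr rfl fun j _ ↦ hshift j, ← Finset.smul_sum,
      Finset.sum_range_succ, Finset.sum_range_succ' f, hf0]
    gcongr

/-- The derivative of `t ↦ σ (log (p t))` for a bounded trace `σ`. -/
lemma hasDerivAt_trace_log [Nontrivial M] (σ : M →L[ℝ] ℝ) (hσ : ∀ a b, σ (a * b) = σ (b * a))
    {p p' : ℝ → M} (hp : ∀ t, HasDerivAt p (p' t) t) (hp' : Continuous p')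
    (hsa : ∀ t, IsSelfAdjoint (p t)) {t₀ : ℝ} (h : IsStrictlyPositive (p t₀)) :
    HasDerivAt (fun t ↦ σ (CFC.log (p t))) (σ ((p t₀)⁻¹ʳ * p' t₀)) t₀ := by
  have hpc : Continuous p := continuous_iff_continuousAt.2 fun t ↦ (hp t).continuousAt
  obtain ⟨c, hc, hcp⟩ := h.exists_algebraMap_le
  set N := ‖p t₀‖ + 1
  have hN : 0 < N := by positivity
  have hpN : p t₀ ≤ algebraMap ℝ M N :=
    (hsa t₀).le_algebraMap_norm_self.trans (algebraMap_mono M (by simp [N]))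
  have hnorm : ‖1 - N⁻¹ • p t₀‖ < 1 := norm_one_sub_smul_lt_one hc hN hcp hpN
  have key := hasDerivAt_trace_log_one_sub σ hσ (y := fun t ↦ 1 - N⁻¹ • p t)
    (y' := fun t ↦ -(N⁻¹ • p' t)) (fun t ↦ ((hp t).const_smul N⁻¹).const_sub 1)
    (by fun_prop) (fun t ↦ (IsSelfAdjoint.one M).sub ((IsSelfAdjoint.all _).smul (hsa t))) hnorm
  have hinv : (1 - (1 - N⁻¹ • p t₀))⁻¹ʳ = N • (p t₀)⁻¹ʳ := by
    have hu := isUnit_one_sub_of_norm_lt_one hnorm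
    rw [← one_mul ((1 - (1 - N⁻¹ • p t₀))⁻¹ʳ), eq_comm, Ring.eq_mul_inverse_iff_mul_eq _ _ _ hu,
      sub_sub_cancel, smul_mul_smul_comm, mul_inv_cancel₀ hN.ne', one_smul,
      Ring.inverse_mul_cancel _ h.isUnit]
  have hval : -σ ((1 - (1 - N⁻¹ • p t₀))⁻¹ʳ * -(N⁻¹ • p' t₀)) = σ ((p t₀)⁻¹ʳ * p' t₀) := by
    rw [hinv, mul_neg, map_neg, neg_neg, smul_mul_smul_comm, mul_inv_cancel₀ hN.ne', one_smul]
  rw [hval] at key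
  refine (key.const_add (σ (algebraMap ℝ M (Real.log N)))).congr_of_eventuallyEq ?_
  have hev : ∀ᶠ t in 𝓝 t₀, ‖1 - N⁻¹ • p t‖ < 1 :=
    (by fun_prop : Continuous fun t ↦ ‖1 - N⁻¹ • p t‖).continuousAt.eventually_lt_const hnorm
  filter_upwards [hev] with t ht
  rw [CFC.log_eq_log_add_log_one_sub hN (hsa t) ht, map_add]

/-- The real part of a tracial state, viewed as a bounded real functional. -/
structure IsRealTrace (σ : M →L[ℝ] ℝ) : Prop where
  protected map_one : σ 1 = 1
  protected nonneg : ∀ a, 0 ≤ a → 0 ≤ σ a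
  protected mul_comm : ∀ a b, σ (a * b) = σ (b * a)
  protected map_star : ∀ a, σ (star a) = σ a

namespace IsRealTrace

variable {σ : M →L[ℝ] ℝ}

lemma trace_log_mono (hσ : IsRealTrace σ) {p q : M} (hp : IsStrictlyPositive p) (hpq : p ≤ q) :
    σ (CFC.log p) ≤ σ (CFC.log q) := by
  have := hσ.nonneg _ (sub_nonneg.2 (CFC.log_le_log hpq hp))
  rw [map_sub] at this
  linarith

lemma trace_log_smul (hσ : IsRealTrace σ) {p : M} (hp : IsStrictlyPositive p) {r : ℝ}
    (hr : 0 < r) : σ (CFC.log (r • p)) = Real.log r + σ (CFC.log p) := by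
  rw [CFC.log_smul' p hr hp, map_add, Algebra.algebraMap_eq_smul_one, map_smul, hσ.map_one,
    smul_eq_mul, mul_one]

lemma hasDerivAt_trace_log_conj [Nontrivial M] (hσ : IsRealTrace σ) {p : M}
    (hp : IsStrictlyPositive p) (y : M) {t₀ : ℝ} (hu : IsUnit (1 + t₀ • y)) :
    HasDerivAt (fun t : ℝ ↦ σ (CFC.log (star (1 + t • y) * p * (1 + t • y))))
      (2 * σ ((1 + t₀ • y)⁻¹ʳ * y)) t₀ := by
  have hb : ∀ t : ℝ, HasDerivAt (fun t : ℝ ↦ 1 + t • y) y t := fun t ↦ by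
    simpa using ((hasDerivAt_id t).smul_const y).const_add 1
  have hbs : ∀ t : ℝ, HasDerivAt (fun t : ℝ ↦ star (1 + t • y)) (star y) t := fun t ↦ by
    simpa using ((hasDerivAt_id t).smul_const (star y)).const_add 1
  have hsa := IsSelfAdjoint.of_nonneg hp.nonneg
  have key := hasDerivAt_trace_log σ hσ.mul_comm
    (fun t ↦ ((hbs t).mul_const p).fun_mul (hb t)) (by fun_prop)
    (fun t ↦ hsa.conjugate' (1 + t • y)) (hu.isStrictlyPositive_star_left_conjugate_iff.2 hp)
  convert! key using 1
  obtain ⟨b, hb⟩ := hu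
  obtain ⟨u, rfl⟩ := hp.isUnit
  rw [← hb, ← Units.coe_star, ← Units.val_mul, ← Units.val_mul, Ring.inverse_unit,
    Ring.inverse_unit, mul_add, map_add, two_mul]
  congr 1
  · calc σ (↑b⁻¹ * y) = σ (star (y * ↑b⁻¹)) := by rw [hσ.map_star, hσ.mul_comm]
      _ = σ (↑(star b)⁻¹ * star y) := by rw [star_mul, ← Units.coe_star, star_inv]
      _ = σ (↑(star b)⁻¹ * star y * u * ↑u⁻¹) := by rw [mul_assoc, Units.mul_inv, mul_one]
      _ = σ (↑u⁻¹ * ↑(star b)⁻¹ * star y * u) := by rw [hσ.mul_comm]; simp only [mul_assoc]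
      _ = σ (↑u⁻¹ * ↑(star b)⁻¹ * star y * u * b * ↑b⁻¹) := by
        rw [mul_assoc (_ * (u : M)), Units.mul_inv, mul_one]
      _ = _ := by
        rw [hσ.mul_comm, mul_inv_rev, mul_inv_rev]
        simp only [Units.val_mul, mul_assoc]
  · rw [mul_inv_rev, mul_inv_rev]
    simp only [Units.val_mul, mul_assoc, Units.inv_mul_cancel_left]

lemma trace_log_conj_sub_trace_log_conj [Nontrivial M] (hσ : IsRealTrace σ) {p q : M}
    (hp : IsStrictlyPositive p) (hq : IsStrictlyPositive q) {y : M}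
    (hu : ∀ t ∈ Icc (0 : ℝ) 1, IsUnit (1 + t • y)) :
    σ (CFC.log (star (1 + y) * p * (1 + y))) - σ (CFC.log (star (1 + y) * q * (1 + y))) =
      σ (CFC.log p) - σ (CFC.log q) := by
  have hder : ∀ t ∈ Icc (0 : ℝ) 1, HasDerivAt
      (fun t : ℝ ↦ σ (CFC.log (star (1 + t • y) * p * (1 + t • y))) -
        σ (CFC.log (star (1 + t • y) * q * (1 + t • y)))) 0 t := fun t ht ↦ by
    simpa using (hσ.hasDerivAt_trace_log_conj hp y (hu t ht)).fun_sub
      (hσ.hasDerivAt_trace_log_conj hq y (hu t ht))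
  simpa using constant_of_has_deriv_right_zero
    (fun t ht ↦ (hder t ht).continuousAt.continuousWithinAt)
    (fun t ht ↦ (hder t (Ico_subset_Icc_self ht)).hasDerivWithinAt) 1 (right_mem_Icc.2 zero_le_one)

lemma trace_log_conj_of_trace_inverse_mul_eq_zero [Nontrivial M] (hσ : IsRealTrace σ) {p : M}
    (hp : IsStrictlyPositive p) {y : M} (hu : ∀ t ∈ Icc (0 : ℝ) 1, IsUnit (1 + t • y))
    (hy : ∀ t ∈ Icc (0 : ℝ) 1, σ ((1 + t • y)⁻¹ʳ * y) = 0) :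
    σ (CFC.log (star (1 + y) * p * (1 + y))) = σ (CFC.log p) := by
  have hder : ∀ t ∈ Icc (0 : ℝ) 1, HasDerivAt
      (fun t : ℝ ↦ σ (CFC.log (star (1 + t • y) * p * (1 + t • y)))) 0 t := fun t ht ↦ by
    simpa [hy t ht] using hσ.hasDerivAt_trace_log_conj hp y (hu t ht)
  simpa using constant_of_has_deriv_right_zero
    (fun t ht ↦ (hder t ht).continuousAt.continuousWithinAt)
    (fun t ht ↦ (hder t (Ico_subset_Icc_self ht)).hasDerivWithinAt) 1 (right_mem_Icc.2 zero_le_one)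

lemma trace_log_star_mul_self_add [Nontrivial M] (hσ : IsRealTrace σ) (y : M) {η : ℝ}
    (hη : 0 < η) : σ (CFC.log (star y * y + η • 1)) = σ (CFC.log (y * star y + η • 1)) := by
  set N := ‖y‖ ^ 2 + η
  have hN : 0 < N := by positivity
  have hnorm : ∀ p : M, 0 ≤ p → p ≤ algebraMap ℝ M (‖y‖ ^ 2) → ‖1 - N⁻¹ • (p + η • 1)‖ < 1 := by
    intro p hp hpN
    refine norm_one_sub_smul_lt_one hη hN ?_ ?_
    · rw [Algebra.algebraMap_eq_smul_one]
      exact le_add_of_nonneg_left hp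
    · rw [map_add, ← Algebra.algebraMap_eq_smul_one]
      gcongr
  have h1 := hnorm _ (star_mul_self_nonneg y) CStarAlgebra.star_mul_le_algebraMap_norm_sq
  have h2 := hnorm _ (mul_star_self_nonneg y) CStarAlgebra.mul_star_le_algebraMap_norm_sq
  have hη' : IsSelfAdjoint (η • (1 : M)) := (IsSelfAdjoint.all η).smul (.one M)
  have hs1 : IsSelfAdjoint (star y * y + η • 1) := (IsSelfAdjoint.star_mul_self y).add hη'
  have hs2 : IsSelfAdjoint (y * star y + η • 1) := (IsSelfAdjoint.mul_star_self y).add hη'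
  rw [CFC.log_eq_log_add_log_one_sub hN hs1 h1, CFC.log_eq_log_add_log_one_sub hN hs2 h2,
    map_add, map_add]
  congr 1
  have e1 := (((IsSelfAdjoint.one M).sub
    ((IsSelfAdjoint.all N⁻¹).smul hs1)).hasSum_log_one_sub h1).mapL σ
  have e2 := (((IsSelfAdjoint.one M).sub
    ((IsSelfAdjoint.all N⁻¹).smul hs2)).hasSum_log_one_sub h2).mapL σ
  have hterm : ∀ n : ℕ, σ (((n : ℝ) + 1)⁻¹ • (1 - N⁻¹ • (star y * y + η • 1)) ^ (n + 1)) =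
      σ (((n : ℝ) + 1)⁻¹ • (1 - N⁻¹ • (y * star y + η • 1)) ^ (n + 1)) := fun n ↦ by
    simpa using congrArg (((n : ℝ) + 1)⁻¹ • ·) (map_aeval_mul_comm hσ.mul_comm (star y) y
      ((1 - N⁻¹ • (.X + η • 1)) ^ (n + 1)))
  simp only [hterm] at e1
  simpa using e1.unique e2

lemma trace_log_mul_mul_self [Nontrivial M] (hσ : IsRealTrace σ) {p h : M}
    (hp : IsStrictlyPositive p) (hh : 1 ≤ h) :
    σ (CFC.log (h * p * h)) = σ (CFC.log p) + σ (CFC.log (h * h)) := by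
  have hu : ∀ t ∈ Icc (0 : ℝ) 1, IsUnit (1 + t • (h - 1)) := fun t ht ↦
    (isStrictlyPositive_one.of_le
      (le_add_of_nonneg_right (smul_nonneg ht.1 (sub_nonneg.2 hh)))).isUnit
  have key := hσ.trace_log_conj_sub_trace_log_conj hp isStrictlyPositive_one hu
  have hsa : star h = h := (IsSelfAdjoint.of_nonneg (zero_le_one.trans hh)).star_eq
  rw [add_sub_cancel, hsa, mul_one, CFC.log_one, map_zero] at key
  linarith

lemma trace_log_star_mul_self_add_le [Nontrivial M] (hσ : IsRealTrace σ) (a : M) {k : M}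
    (hk : 1 ≤ k) {η : ℝ} (hη : 0 < η) :
    σ (CFC.log (star a * a + η • 1)) + σ (CFC.log k) ≤
      σ (CFC.log (star a * k * a + (η * ‖k‖) • 1)) := by
  have hk0 : (0 : M) ≤ k := zero_le_one.trans hk
  have hkpos : IsStrictlyPositive k := isStrictlyPositive_one.of_le hk
  have hknorm : 0 < ‖k‖ := norm_pos_iff.2 hkpos.isUnit.ne_zero
  set h := CFC.sqrt k
  have hh : h * h = k := CFC.sqrt_mul_sqrt_self k
  have h1 : 1 ≤ h := by simpa using CFC.sqrt_le_sqrt 1 k hk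
  have hsa : star h = h := (IsSelfAdjoint.of_nonneg (zero_le_one.trans h1)).star_eq
  have hη1 : IsStrictlyPositive (η • (1 : M)) := isStrictlyPositive_one.smul hη
  have hp : IsStrictlyPositive (a * star a + η • 1) := hη1.nonneg_add (mul_star_self_nonneg a)
  have hexp : h * (a * star a + η • 1) * h = h * a * star (h * a) + η • k := by
    rw [mul_add, add_mul, star_mul, hsa, ← hh, mul_smul_comm, mul_one, smul_mul_assoc]
    simp only [mul_assoc]
  rw [hσ.trace_log_star_mul_self_add a hη, ← hh, ← hσ.trace_log_mul_mul_self hp h1, hh, hexp]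
  calc σ (CFC.log (h * a * star (h * a) + η • k))
      ≤ σ (CFC.log (h * a * star (h * a) + (η * ‖k‖) • 1)) := by
        refine hσ.trace_log_mono ((hkpos.smul hη).nonneg_add (mul_star_self_nonneg _)) ?_
        rw [mul_smul, ← Algebra.algebraMap_eq_smul_one]
        gcongr
        exact (IsSelfAdjoint.of_nonneg hk0).le_algebraMap_norm_self
    _ = σ (CFC.log (star a * k * a + (η * ‖k‖) • 1)) := by
        rw [← hσ.trace_log_star_mul_self_add _ (by positivity), star_mul, hsa, ← hh]
        simp only [mul_assoc]

lemma trace_log_conj_one_add_smul [Nontrivial M] (hσ : IsRealTrace σ) {p : M}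
    (hp : IsStrictlyPositive p) {x : M} (hx : spectralRadius ℂ x ≤ 1)
    (hm : ∀ m : ℕ, 1 ≤ m → σ (x ^ m) = 0) {r : ℝ} (hr0 : 0 ≤ r) (hr : r < 1) :
    σ (CFC.log (star (1 + r • x) * p * (1 + r • x))) = σ (CFC.log p) := by
  have hz : ∀ t ∈ Icc (0 : ℝ) 1, Tendsto (fun n : ℕ ↦ (t • r • x) ^ n) atTop (𝓝 0) :=
    fun t ht ↦ by
      rw [smul_smul]
      exact tendsto_smul_pow_of_spectralRadius_le_one hx (mul_nonneg ht.1 hr0)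
        ((mul_le_of_le_one_left hr0 ht.2).trans_lt hr)
  refine hσ.trace_log_conj_of_trace_inverse_mul_eq_zero hp
    (fun t ht ↦ isUnit_one_add_of_tendsto_pow (hz t ht))
    fun t ht ↦ map_inverse_one_add_mul_eq_zero (hz t ht) fun m h ↦ ?_
  rw [smul_pow, map_smul, hm m h, smul_zero]

lemma exists_trace_log_star_mul_self_add_le [Nontrivial M] (hσ : IsRealTrace σ) {x : M}
    (hx : spectralRadius ℂ x ≤ 1) (hm : ∀ m : ℕ, 1 ≤ m → σ (x ^ m) = 0) {s : ℝ} (hs : 1 < s) :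
    ∃ η : ℝ, 0 < η ∧ σ (CFC.log (star (1 + x) * (1 + x) + η • 1)) ≤ Real.log (s ^ 3) := by
  obtain ⟨k, hk1, hkx⟩ := exists_one_le_star_mul_mul_le hx hs
  have hs0 : 0 < s := by linarith
  have hkpos : IsStrictlyPositive k := isStrictlyPositive_one.of_le hk1
  have hknorm : 0 < ‖k‖ := norm_pos_iff.2 hkpos.isUnit.ne_zero
  set r := (s ^ 2)⁻¹
  have hr0 : 0 < r := by positivity
  have hr1 : r < 1 := inv_lt_one_of_one_lt₀ (by nlinarith)
  set b := 1 + r • x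
  have hb : IsUnit b := isUnit_one_add_of_tendsto_pow
    (tendsto_smul_pow_of_spectralRadius_le_one hx hr0.le hr1)
  have hbk : IsStrictlyPositive (star b * k * b) :=
    hb.isStrictlyPositive_star_left_conjugate_iff.2 hkpos
  obtain ⟨c, hc, hcb⟩ := hbk.exists_algebraMap_le
  have hle : star (1 + x) * k * (1 + x) ≤ s ^ 2 • (star b * k * b) := by
    have hdiff : s ^ 2 • (star b * k * b) - star (1 + x) * k * (1 + x) =
        (1 - r) • (s ^ 2 • k - star x * k * x) := by
      have hrs : s ^ 2 * r = 1 := mul_inv_cancel₀ (by positivity)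
      simp only [b, star_add, star_one, star_smul, star_trivial, add_mul, mul_add, one_mul, mul_one,
        smul_add, smul_sub, sub_smul, one_smul, smul_mul_assoc, mul_smul_comm, smul_smul, hrs]
      have hrs' : (1 - r) * s ^ 2 = s ^ 2 - 1 := by linear_combination -hrs
      rw [hrs', ← mul_assoc (s ^ 2), hrs, one_mul, sub_smul, one_smul]
      abel
    rw [← sub_nonneg, hdiff]
    exact smul_nonneg (by linarith) (sub_nonneg.2 hkx)
  have hd : 0 < s ^ 3 - s ^ 2 := by nlinarith [pow_pos hs0 2]
  have hη : 0 < (s ^ 3 - s ^ 2) * c / ‖k‖ := by positivity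
  refine ⟨_, hη, ?_⟩
  have h1 := hσ.trace_log_star_mul_self_add_le (1 + x) hk1 hη
  rw [div_mul_cancel₀ _ hknorm.ne'] at h1
  have h2 : σ (CFC.log (star (1 + x) * k * (1 + x) + ((s ^ 3 - s ^ 2) * c) • 1)) ≤
      σ (CFC.log (s ^ 3 • (star b * k * b))) := by
    refine hσ.trace_log_mono ((isStrictlyPositive_one.smul (mul_pos hd hc)).nonneg_add
      (star_left_conjugate_nonneg hkpos.nonneg _)) ?_
    have : s ^ 3 • (star b * k * b) =
        s ^ 2 • (star b * k * b) + (s ^ 3 - s ^ 2) • (star b * k * b) := by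
      rw [← add_smul, add_sub_cancel]
    rw [this, mul_smul, ← Algebra.algebraMap_eq_smul_one]
    gcongr
  rw [hσ.trace_log_smul hbk (by positivity),
    hσ.trace_log_conj_one_add_smul hkpos hx hm hr0.le hr1] at h2
  linarith

lemma trace_log_star_mul_self_add_nonneg [Nontrivial M] (hσ : IsRealTrace σ) {x : M}
    (hx : spectralRadius ℂ x ≤ 1) (hm : ∀ m : ℕ, 1 ≤ m → σ (x ^ m) = 0) {η : ℝ} (hη : 0 < η) :
    0 ≤ σ (CFC.log (star (1 + x) * (1 + x) + η • 1)) := by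
  set f : ℝ → M := fun r ↦ star (1 + r • x) * 1 * (1 + r • x) - star (1 + x) * (1 + x)
  have hf : Continuous f := by fun_prop
  have hf1 : ‖f 1‖ < η := by simpa [f] using hη
  have hev : ∀ᶠ r in 𝓝[<] (1 : ℝ), ‖f r‖ < η :=
    (hf.norm.continuousAt.eventually_lt_const hf1).filter_mono nhdsWithin_le_nhds
  obtain ⟨r, hr, hr0, hr1⟩ := (hev.and (Ioo_mem_nhdsLT (zero_lt_one (α := ℝ)))).exists
  have hb : IsUnit (1 + r • x) := isUnit_one_add_of_tendsto_pow
    (tendsto_smul_pow_of_spectralRadius_le_one hx hr0.le hr1)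
  have key := hσ.trace_log_conj_one_add_smul isStrictlyPositive_one hx hm hr0.le hr1
  rw [CFC.log_one, map_zero] at key
  rw [← key]
  refine hσ.trace_log_mono
    (hb.isStrictlyPositive_star_left_conjugate_iff.2 isStrictlyPositive_one) ?_
  have hsa : IsSelfAdjoint (f r) :=
    ((IsSelfAdjoint.one M).conjugate' _).sub (.star_mul_self _)
  have := hsa.le_algebraMap_norm_self.trans (algebraMap_mono M hr.le)
  rw [Algebra.algebraMap_eq_smul_one] at this
  exact sub_le_iff_le_add'.1 this

end IsRealTrace

lemma fkDet_eq_one_of_forall [Nontrivial M] (τ : M →ₗ[ℂ] ℂ) {σ : M →L[ℝ] ℝ} (hσ : IsRealTrace σ)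
    (hτσ : ∀ a, σ a = (τ a).re) (a : M)
    (hlower : ∀ η : ℝ, 0 < η → 0 ≤ σ (CFC.log (star a * a + η • 1)))
    (hupper : ∀ s : ℝ, 1 < s →
      ∃ η : ℝ, 0 < η ∧ σ (CFC.log (star a * a + η • 1)) ≤ Real.log (s ^ 3)) :
    fkDet τ a = 1 := by
  set p := cstarAbs a
  have hp : 0 ≤ p := CFC.sqrt_nonneg _
  have hpp : p * p = star a * a := CFC.sqrt_mul_sqrt_self _ (star_mul_self_nonneg a)
  have hone : ∀ {η : ℝ}, 0 < η → IsStrictlyPositive (η • (1 : M)) := fun h ↦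
    isStrictlyPositive_one.smul h
  have hsq : ∀ ε : ℝ, (p + ε • 1) ^ 2 = star a * a + ε ^ 2 • 1 + (2 * ε) • p := fun ε ↦ by
    rw [← hpp, sq, add_mul, mul_add, mul_add, smul_mul_smul_comm, smul_one_mul, mul_smul_one,
      one_mul, ← sq ε, two_mul, add_smul]
    abel
  have hlog : ∀ ε : ℝ, 0 < ε → σ (CFC.log (star a * a + ε ^ 2 • 1 + (2 * ε) • p)) =
      2 * σ (CFC.log (p + ε • 1)) := fun ε hε ↦ by
    rw [← hsq, CFC.log_pow' 2 _ ((hone hε).nonneg_add hp), map_nsmul, nsmul_eq_mul, Nat.cast_ofNat]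
  have hge : ∀ ε : ℝ, 0 < ε → 0 ≤ σ (CFC.log (p + ε • 1)) := fun ε hε ↦ by
    have := (hlower _ (pow_pos hε 2)).trans (hσ.trace_log_mono
      ((hone (pow_pos hε 2)).nonneg_add (star_mul_self_nonneg a))
      (le_add_of_nonneg_right (smul_nonneg (by positivity : 0 ≤ 2 * ε) hp)))
    rw [hlog ε hε] at this
    linarith
  have hbdd : BddBelow (range fun ε : {ε : ℝ // 0 < ε} ↦
      Real.exp ((τ (CFC.log (p + (ε : ℝ) • 1))).re)) :=
    ⟨0, by rintro _ ⟨ε, rfl⟩; positivity⟩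
  have : Nonempty {ε : ℝ // 0 < ε} := ⟨⟨1, one_pos⟩⟩
  refine le_antisymm ?_ (le_ciInf fun ε ↦ ?_)
  · have hs : ∀ s : ℝ, 1 < s → fkDet τ a ≤ s ^ 3 := fun s hs ↦ by
      obtain ⟨η, hη, h⟩ := hupper s hs
      have hlim : ContinuousAt (fun ε : ℝ ↦ ε ^ 2 + 2 * ε * ‖p‖) 0 := by fun_prop
      have hev : ∀ᶠ ε in 𝓝[>] (0 : ℝ), ε ^ 2 + 2 * ε * ‖p‖ < η :=
        (hlim.eventually_lt_const (by simpa using hη)).filter_mono nhdsWithin_le_nhds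
      obtain ⟨ε, hεη, hε⟩ := (hev.and self_mem_nhdsWithin).exists
      replace hε : 0 < ε := hε
      have hle : star a * a + ε ^ 2 • 1 + (2 * ε) • p ≤ star a * a + η • 1 := by
        have : η • (1 : M) = ε ^ 2 • 1 + (η - ε ^ 2) • 1 := by rw [← add_smul, add_sub_cancel]
        rw [this, ← add_assoc]
        gcongr
        calc (2 * ε) • p ≤ (2 * ε) • algebraMap ℝ M ‖p‖ := by
              gcongr
              exact (IsSelfAdjoint.of_nonneg hp).le_algebraMap_norm_self
          _ = (2 * ε * ‖p‖) • 1 := by rw [Algebra.algebraMap_eq_smul_one, smul_smul]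
          _ ≤ (η - ε ^ 2) • 1 := smul_le_smul_of_nonneg_right (by linarith) zero_le_one
      have h2 := (hσ.trace_log_mono (((hone (pow_pos hε 2)).nonneg_add
        (star_mul_self_nonneg a)).add_nonneg (smul_nonneg (by positivity) hp)) hle).trans h
      rw [hlog ε hε] at h2
      have h0 := hge ε hε
      refine (ciInf_le hbdd ⟨ε, hε⟩).trans ?_
      rw [← Real.le_log_iff_exp_le (by positivity), ← hτσ]
      change σ (CFC.log (p + ε • 1)) ≤ _
      linarith
    have hlim : Tendsto (fun s : ℝ ↦ s ^ 3) (𝓝[>] 1) (𝓝 1) := by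
      have : ContinuousAt (fun s : ℝ ↦ s ^ 3) 1 := by fun_prop
      simpa using this.tendsto.mono_left nhdsWithin_le_nhds
    exact ge_of_tendsto hlim (eventually_nhdsWithin_of_forall hs)
  · rw [← hτσ]
    exact Real.one_le_exp (hge ε ε.2)

lemma fkDet_one_add_eq_one_of_spectralRadius_le_one (τ : M →ₗ[ℂ] ℂ) (hτ1 : τ 1 = 1)
    (hτpos : ∀ a : M, 0 ≤ a → 0 ≤ τ a) (hτtr : ∀ a b : M, τ (a * b) = τ (b * a)) {x : M}
    (hx : spectralRadius ℂ x ≤ 1) (hm : ∀ m : ℕ, 1 ≤ m → τ (x ^ m) = 0) :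
    fkDet τ (1 + x) = 1 := by
  have : Nontrivial M := ⟨1, 0, fun h ↦ by simp [h] at hτ1⟩
  set τ' : M →ₚ[ℂ] ℂ := PositiveLinearMap.mk₀ τ hτpos
  have hcont : Continuous τ := map_continuous τ'
  let σ : M →L[ℝ] ℝ := Complex.reCLM.comp ⟨τ.restrictScalars ℝ, hcont⟩
  have hτσ : ∀ a, σ a = (τ a).re := fun _ ↦ rfl
  have hσ : IsRealTrace σ :=
    { map_one := by rw [hτσ, hτ1, Complex.one_re]
      nonneg := fun a ha ↦ (Complex.le_def.1 (hτpos a ha)).1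
      mul_comm := fun a b ↦ by rw [hτσ, hτσ, hτtr]
      map_star := fun a ↦ by
        have : τ (star a) = star (τ a) := map_star τ' a
        rw [hτσ, hτσ, this, Complex.star_def, Complex.conj_re] }
  have hm' : ∀ m : ℕ, 1 ≤ m → σ (x ^ m) = 0 := fun m h ↦ by rw [hτσ, hm m h, Complex.zero_re]
  exact fkDet_eq_one_of_forall τ hσ hτσ (1 + x)
    (fun _ ↦ hσ.trace_log_star_mul_self_add_nonneg hx hm')
    fun _ ↦ hσ.exists_trace_log_star_mul_self_add_le hx hm'

end

/-- Let `M` be a unital C*-algebra with a tracial state `τ`. If `x ∈ M`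
satisfies `r(x) ≤ 1` and `τ(x^m) = 0` for all `m ≥ 1`, then `Δ_τ(1 + x) = 1`. Equivalently,
if `a ∈ M` satisfies `r(1 − a) ≤ 1` and `τ(a^m) = 1` for all `m ≥ 1`, then `Δ_τ(a) = 1`. -/
theorem fkDet_one_add_eq_one_of_trace_powers_zero
    {M : Type*} [CStarAlgebra M] [PartialOrder M] [StarOrderedRing M]
    (τ : M →ₗ[ℂ] ℂ)
    (hτ1 : τ 1 = 1)
    (hτpos : ∀ a : M, 0 ≤ a → 0 ≤ τ a)
    (hτtr : ∀ a b : M, τ (a * b) = τ (b * a)) :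
    (∀ x : M, spectralRadius ℂ x ≤ 1 → (∀ m : ℕ, 1 ≤ m → τ (x ^ m) = 0) →
        fkDet τ (1 + x) = 1) ∧
      (∀ a : M, spectralRadius ℂ (1 - a) ≤ 1 → (∀ m : ℕ, 1 ≤ m → τ (a ^ m) = 1) →
        fkDet τ a = 1) := by
  refine ⟨fun x hx hm ↦ fkDet_one_add_eq_one_of_spectralRadius_le_one τ hτ1 hτpos hτtr hx hm,
    fun a ha hm ↦ ?_⟩
  have hpoly : ∀ q : Polynomial ℂ, τ (Polynomial.aeval a q) = q.eval 1 := fun q ↦ by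
    have hpow : ∀ m : ℕ, τ (a ^ m) = 1 := fun m ↦ by
      rcases m.eq_zero_or_pos with rfl | h
      · rw [pow_zero, hτ1]
      · exact hm m h
    rw [Polynomial.aeval_eq_sum_range, map_sum, Polynomial.eval_eq_sum_range]
    simp [hpow]
  have hr : spectralRadius ℂ (a - 1) ≤ 1 := by
    rw [← neg_sub, spectralRadius, ← spectrum.neg_eq]
    refine iSup₂_le fun k hk ↦ ?_
    rw [← nnnorm_neg]
    exact (le_iSup₂ (f := fun (l : ℂ) (_ : l ∈ spectrum ℂ (1 - a)) ↦ (‖l‖₊ : ENNReal)) (-k)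
      hk).trans ha
  have hm' : ∀ m : ℕ, 1 ≤ m → τ ((a - 1) ^ m) = 0 := fun m h ↦ by
    have := hpoly ((.X - 1) ^ m)
    simpa [Nat.one_le_iff_ne_zero.1 h] using this
  simpa using fkDet_one_add_eq_one_of_spectralRadius_le_one τ hτ1 hτpos hτtr hr hm'
end

section
/- Let M be a unital C*-algebra with a tracial state τ, let D be a C*-subalgebra of M containing the unit, let A be a unital subalgebra of M containing D, and let Φ : A → D be a unital algebra homomorphism with Φ(d) = d for all d ∈ D and τ(Φ(a)) = τ(a) for all a ∈ A. Then A satisfies the ball-Jensen equality: Δ_τ(1 + x) = 1 for every x ∈ A with Φ(x) = 0 and r(x) ≤ 1. -/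
open scoped ComplexOrder

section LogTrace

open Filter Topology

variable {M : Type*} [CStarAlgebra M] [PartialOrder M]

/-- The real part of a tracial state, as a real-linear functional. -/
structure IsRealTrace_s5 (ρ : M →L[ℝ] ℝ) : Prop where
  map_one : ρ 1 = 1
  nonneg : ∀ a, 0 ≤ a → 0 ≤ ρ a
  tracial : ∀ a b, ρ (a * b) = ρ (b * a)
  map_star : ∀ a, ρ (star a) = ρ a

namespace IsRealTrace_s5

variable {ρ : M →L[ℝ] ℝ} (hρ : IsRealTrace_s5 ρ)
include hρ

lemma map_algebraMap (r : ℝ) : ρ (algebraMap ℝ M r) = r := by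
  rw [Algebra.algebraMap_eq_smul_one, map_smul, hρ.map_one]; simp

lemma nontrivial : Nontrivial M :=
  ⟨0, 1, fun h => by have := hρ.map_one; rw [← h, map_zero] at this; norm_num at this⟩

variable [StarOrderedRing M]

lemma mono {a b : M} (h : a ≤ b) : ρ a ≤ ρ b := by
  have := hρ.nonneg (b - a) (sub_nonneg.2 h)
  rw [map_sub] at this
  linarith

lemma log_le_log {a b : M} (ha : IsStrictlyPositive a) (h : a ≤ b) :
    ρ (CFC.log a) ≤ ρ (CFC.log b) :=
  hρ.mono (CFC.log_le_log h)

lemma log_smul {a : M} (ha : IsStrictlyPositive a) {c : ℝ} (hc : 0 < c) :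
    ρ (CFC.log (c • a)) = Real.log c + ρ (CFC.log a) := by
  rw [CFC.log_smul' a hc, map_add, hρ.map_algebraMap]

end IsRealTrace_s5

variable [StarOrderedRing M]

lemma exists_pos_algebraMap_le [Nontrivial M] {a : M} (ha : IsStrictlyPositive a) :
    ∃ r > 0, algebraMap ℝ M r ≤ a :=
  (CFC.exists_pos_algebraMap_le_iff (a := a)).2 fun _ hx => ha.spectrum_pos hx

lemma norm_one_sub_lt_one [Nontrivial M] {a : M} (ha : IsStrictlyPositive a) {c : ℝ} (hc : 0 < c)
    (hac : a ≤ algebraMap ℝ M c) : ‖1 - c⁻¹ • a‖ < 1 := by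
  obtain ⟨r, hr, hra⟩ := exists_pos_algebraMap_le ha
  have hrc : r ≤ c := by
    have := hra.trans hac
    exact (algebraMap_le_algebraMap (α := ℝ) (β := M)).1 this
  have h0 : 0 ≤ 1 - c⁻¹ • a := by
    have := smul_le_smul_of_nonneg_left hac (inv_nonneg.2 hc.le)
    rw [Algebra.algebraMap_eq_smul_one, smul_smul, inv_mul_cancel₀ hc.ne', one_smul] at this
    exact sub_nonneg.2 this
  have h1 : 1 - c⁻¹ • a ≤ algebraMap ℝ M (1 - r / c) := by
    have := smul_le_smul_of_nonneg_left hra (inv_nonneg.2 hc.le)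
    rw [Algebra.algebraMap_eq_smul_one, smul_smul] at this
    rw [Algebra.algebraMap_eq_smul_one, sub_smul, one_smul, div_eq_inv_mul]
    exact sub_le_sub_left this 1
  have h2 := (CStarAlgebra.norm_le_iff_le_algebraMap _
    (sub_nonneg.2 ((div_le_one hc).2 hrc)) h0).2 h1
  have : 0 < r / c := by positivity
  linarith

omit [PartialOrder M] [StarOrderedRing M] in
lemma tendsto_log_one_sub {u : M} (hu : IsSelfAdjoint u) (hu1 : ‖u‖ < 1) :
    Tendsto (fun n : ℕ => ∑ i ∈ Finset.range n, ((i : ℝ) + 1)⁻¹ • u ^ (i + 1)) atTop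
      (𝓝 (-CFC.log (1 - u))) := by
  nontriviality M
  have hspec : ∀ x ∈ spectrum ℝ u, |x| ≤ ‖u‖ := fun x hx => by
    simpa using spectrum.norm_le_norm_of_mem hx
  have hcont : ContinuousOn (fun x : ℝ => Real.log (1 - x)) (spectrum ℝ u) := by
    refine ContinuousOn.log (by fun_prop) fun x hx => ?_
    have := (abs_le.1 (hspec x hx)).2
    linarith
  have hlog : CFC.log (1 - u) = cfc (fun x : ℝ => Real.log (1 - x)) u := by
    have h1 : cfc (fun x : ℝ => 1 - x) u = 1 - u := by
      rw [cfc_sub (fun _ => (1 : ℝ)) (fun x => x) u, cfc_const_one ℝ u, cfc_id' ℝ u]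
    have h2 : ContinuousOn Real.log ((fun x : ℝ => 1 - x) '' spectrum ℝ u) := by
      rintro _ ⟨x, hx, rfl⟩
      refine (Real.continuousAt_log ?_).continuousWithinAt
      have := (abs_le.1 (hspec x hx)).2
      simp only
      linarith
    rw [← h1, CFC.log, ← cfc_comp' Real.log (fun x : ℝ => 1 - x) u h2]
  have hpoly : ∀ n : ℕ, ∑ i ∈ Finset.range n, ((i : ℝ) + 1)⁻¹ • u ^ (i + 1) =
      cfc (∑ i ∈ Finset.range n, fun x : ℝ => ((i : ℝ) + 1)⁻¹ • x ^ (i + 1)) u := by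
    intro n
    rw [cfc_sum _ u _]
    refine Finset.sum_congr rfl fun i _ => ?_
    rw [cfc_smul _ (fun x : ℝ => x ^ (i + 1)) u, cfc_pow_id u (i + 1)]
  have hbound : ∀ n : ℕ, ‖∑ i ∈ Finset.range n, ((i : ℝ) + 1)⁻¹ • u ^ (i + 1) -
      -CFC.log (1 - u)‖ ≤ ‖u‖ ^ (n + 1) / (1 - ‖u‖) := by
    intro n
    rw [sub_neg_eq_add, hpoly, hlog, ← cfc_add u _ _ (by
      rw [Finset.sum_fn]; fun_prop) hcont]
    refine norm_cfc_le (div_nonneg (by positivity) (by linarith)) fun x hx => ?_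
    have hx' := hspec x hx
    have := Real.abs_log_sub_add_sum_range_le (x := x) (by linarith) n
    rw [Finset.sum_apply, Real.norm_eq_abs]
    simp only [smul_eq_mul, ← div_eq_inv_mul]
    refine this.trans ?_
    gcongr
  rw [tendsto_iff_norm_sub_tendsto_zero]
  refine squeeze_zero (fun _ => norm_nonneg _) hbound ?_
  have := ((tendsto_pow_atTop_nhds_zero_of_lt_one (norm_nonneg u) hu1).comp
    (tendsto_add_atTop_nat 1)).div_const (1 - ‖u‖)
  simpa using this

/-- The series `∑ ρ(u ^ (n + 1)) / (n + 1)`, which is `-ρ(log (1 - u))` for self-adjoint `u` of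
norm less than one. -/
noncomputable def logSeries (ρ : M →L[ℝ] ℝ) (u : M) : ℝ :=
  ∑' n : ℕ, ((n : ℝ) + 1)⁻¹ * ρ (u ^ (n + 1))

omit [PartialOrder M] [StarOrderedRing M] in
lemma summable_logSeries (ρ : M →L[ℝ] ℝ) {u : M} (hu : ‖u‖ < 1) :
    Summable fun n : ℕ => ((n : ℝ) + 1)⁻¹ * ρ (u ^ (n + 1)) := by
  refine Summable.of_norm_bounded
    (((summable_geometric_of_lt_one (norm_nonneg u) hu).mul_left (‖ρ‖ * ‖u‖))) fun n => ?_
  rw [norm_mul, Real.norm_of_nonneg (by positivity : (0 : ℝ) ≤ ((n : ℝ) + 1)⁻¹), mul_assoc,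
    ← pow_succ']
  refine (mul_le_of_le_one_left (norm_nonneg _) (inv_le_one_of_one_le₀ (by simp))).trans ?_
  refine (ρ.le_opNorm _).trans ?_
  gcongr
  exact norm_pow_le' u n.succ_pos

namespace IsRealTrace_s5

variable {ρ : M →L[ℝ] ℝ} (hρ : IsRealTrace_s5 ρ)
include hρ

lemma log_eq_logSeries {a : M} (ha : IsStrictlyPositive a) {c : ℝ} (hc : 0 < c)
    (hac : ‖1 - c⁻¹ • a‖ < 1) :
    ρ (CFC.log a) = Real.log c - logSeries ρ (1 - c⁻¹ • a) := by
  have hsa : IsSelfAdjoint (1 - c⁻¹ • a) :=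
    (IsSelfAdjoint.one M).sub ((IsSelfAdjoint.all (c⁻¹)).smul (IsSelfAdjoint.of_nonneg ha.nonneg))
  have h1 := (ρ.continuous.tendsto _).comp (tendsto_log_one_sub hsa hac)
  have h2 := (summable_logSeries ρ hac).hasSum.tendsto_sum_nat
  have h3 : ρ (-CFC.log (1 - (1 - c⁻¹ • a))) = logSeries ρ (1 - c⁻¹ • a) := by
    refine tendsto_nhds_unique h1 (h2.congr fun n => ?_)
    simp [map_sum]
  rw [sub_sub_cancel, map_neg, hρ.log_smul ha (inv_pos.2 hc), Real.log_inv] at h3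
  linarith

omit [StarOrderedRing M] in
lemma hasFDerivAt_pow (n : ℕ) (u : M) :
    HasFDerivAt (fun v : M => ((n : ℝ) + 1)⁻¹ * ρ (v ^ (n + 1)))
      (ρ.comp (ContinuousLinearMap.mul ℝ M (u ^ n))) u := by
  have h := (ρ.hasFDerivAt.comp u (hasFDerivAt_pow' (𝕜 := ℝ) (n + 1) (x := u))).const_mul
    ((n : ℝ) + 1)⁻¹
  refine h.congr_fderiv ?_
  ext v
  have hsum : ∀ i ∈ Finset.range (n + 1), ρ (u ^ (n - i) * v * u ^ i) = ρ (u ^ n * v) := by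
    intro i hi
    rw [hρ.tracial, ← mul_assoc, ← pow_add,
      Nat.add_sub_of_le (Nat.lt_succ_iff.1 (Finset.mem_range.1 hi))]
  have hn : (n : ℝ) + 1 ≠ 0 := by positivity
  simp [map_sum, Finset.sum_congr rfl hsum, hn]

omit [StarOrderedRing M] in
lemma hasFDerivAt_logSeries {u k : M} (hu : ‖u‖ < 1) (hk : k * (1 - u) = 1) :
    HasFDerivAt (logSeries ρ) (ρ.comp (ContinuousLinearMap.mul ℝ M k)) u := by
  obtain ⟨r, hur, hr⟩ := exists_between hu
  have hr0 : 0 ≤ r := (norm_nonneg u).trans hur.le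
  have hnorm : ∀ (n : ℕ) (x : M), x ∈ Metric.ball (0 : M) r →
      ‖ρ.comp (ContinuousLinearMap.mul ℝ M (x ^ n))‖ ≤ ‖ρ‖ * (‖(1 : M)‖ + 1) * r ^ n := by
    intro n x hx
    rw [mem_ball_zero_iff] at hx
    refine (ContinuousLinearMap.opNorm_comp_le _ _).trans ?_
    rw [mul_assoc]
    gcongr
    refine (ContinuousLinearMap.opNorm_mul_apply_le ℝ M _).trans ?_
    rcases Nat.eq_zero_or_pos n with rfl | hn
    · simp
    · refine (norm_pow_le' x hn).trans ?_
      have : ‖x‖ ^ n ≤ r ^ n := by gcongr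
      nlinarith [norm_nonneg (1 : M), pow_nonneg hr0 n]
  have h := hasFDerivAt_tsum_of_isPreconnected
    ((summable_geometric_of_lt_one hr0 hr).mul_left (‖ρ‖ * (‖(1 : M)‖ + 1)))
    Metric.isOpen_ball (convex_ball (0 : M) r).isPreconnected
    (fun n x _ => hρ.hasFDerivAt_pow n x) hnorm (mem_ball_zero_iff.2 hur)
    (summable_logSeries ρ hu) (mem_ball_zero_iff.2 hur)
  refine h.congr_fderiv ?_
  have hs : Summable fun n : ℕ => u ^ n := summable_geometric_of_norm_lt_one hu
  have hk' : ∑' n : ℕ, u ^ n = k := by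
    have h1 := geom_series_mul_neg u hu
    have h2 := mul_neg_geom_series u hu
    calc ∑' n : ℕ, u ^ n = k * (1 - u) * ∑' n : ℕ, u ^ n := by rw [hk, one_mul]
      _ = k := by rw [mul_assoc, h2, mul_one]
  have := ((ContinuousLinearMap.compL ℝ M M ℝ ρ).comp (ContinuousLinearMap.mul ℝ M)).map_tsum hs
  rw [hk'] at this
  exact this.symm

lemma hasDerivWithinAt_log {S : Set ℝ} {h : ℝ → M} {h' k : M} {s : ℝ}
    (hd : HasDerivWithinAt h h' S s) (hpos : ∀ t ∈ S, IsStrictlyPositive (h t)) (hs : s ∈ S)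
    (hk : k * h s = 1) :
    HasDerivWithinAt (fun t => ρ (CFC.log (h t))) (ρ (k * h')) S s := by
  have := hρ.nontrivial
  set c : ℝ := ‖h s‖ + 1
  have hc : 0 < c := by positivity
  have hlt : ‖1 - c⁻¹ • h s‖ < 1 := by
    refine norm_one_sub_lt_one (hpos s hs) hc ?_
    refine (IsSelfAdjoint.of_nonneg (hpos s hs).nonneg).le_algebraMap_norm_self.trans ?_
    exact (algebraMap_le_algebraMap (α := ℝ) (β := M)).2 (by simp [c])
  have hcd : HasDerivWithinAt (fun t => 1 - c⁻¹ • h t) (-(c⁻¹ • h')) S s :=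
    (hd.const_smul c⁻¹).const_sub 1
  have hF := hρ.hasFDerivAt_logSeries (k := c • k) hlt (by
    rw [sub_sub_cancel, smul_mul_smul_comm, hk, mul_inv_cancel₀ hc.ne', one_smul])
  have hmain := (hF.comp_hasDerivWithinAt s hcd).const_sub (Real.log c)
  have heq : (fun t => ρ (CFC.log (h t))) =ᶠ[𝓝[S] s]
      fun t => Real.log c - (logSeries ρ ∘ fun t => 1 - c⁻¹ • h t) t := by
    have hev : ∀ᶠ t in 𝓝[S] s, ‖1 - c⁻¹ • h t‖ < 1 :=
      hcd.continuousWithinAt.norm.eventually_lt_const hlt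
    filter_upwards [hev, self_mem_nhdsWithin] with t ht htS
    exact hρ.log_eq_logSeries (hpos t htS) hc ht
  refine (hmain.congr_of_eventuallyEq heq (heq.self_of_nhdsWithin hs)).congr_deriv ?_
  simp [hc.ne']

end IsRealTrace_s5

lemma isStrictlyPositive_star_mul_self {b : M} (hb : IsUnit b) :
    IsStrictlyPositive (star b * b) :=
  ⟨star_mul_self_nonneg b, hb.star.mul hb⟩

lemma isStrictlyPositive_smul_one {c : ℝ} (hc : 0 < c) : IsStrictlyPositive (c • (1 : M)) :=
  (isStrictlyPositive_one : IsStrictlyPositive (1 : M)).smul hc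

/-- A version of Gelfand's formula bounding the powers of an element. -/
lemma eventually_norm_pow_le_of_spectralRadius_le_one {M : Type*} [CStarAlgebra M] {x : M}
    (hx : spectralRadius ℂ x ≤ 1) {r : ℝ} (hr : 1 < r) : ∀ᶠ n : ℕ in atTop, ‖x ^ n‖ ≤ r ^ n := by
  have hr0 : 0 < r := one_pos.trans hr
  have hxr : spectralRadius ℂ x < ENNReal.ofReal r :=
    hx.trans_lt (by rwa [← ENNReal.ofReal_one, ENNReal.ofReal_lt_ofReal_iff hr0])
  filter_upwards [(spectrum.pow_norm_pow_one_div_tendsto_nhds_spectralRadius x).eventually_lt_const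
    hxr, eventually_gt_atTop 0] with n hn hn0
  have h := ((ENNReal.ofReal_lt_ofReal_iff hr0).1 hn).le
  have := pow_le_pow_left₀ (by positivity) h n
  rwa [← Real.rpow_natCast, ← Real.rpow_mul (norm_nonneg _), one_div,
    inv_mul_cancel₀ (by positivity), Real.rpow_one] at this

lemma summable_norm_smul_pow {M : Type*} [CStarAlgebra M] {x : M}
    (hx : spectralRadius ℂ x ≤ 1) {s : ℝ} (hs0 : 0 < s) (hs : s < 1) :
    Summable fun n : ℕ => ‖(s • x) ^ n‖ := by
  obtain ⟨r, hr1, hr⟩ := exists_between (one_lt_inv₀ hs0 |>.2 hs)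
  have hr0 : 0 < r := one_pos.trans hr1
  have hsr : s * r < 1 := by rwa [lt_inv_comm₀ hr0 hs0, ← one_div, lt_div_iff₀ hr0] at hr
  refine Summable.of_norm_bounded_eventually_nat
    (summable_geometric_of_lt_one (by positivity) hsr) ?_
  filter_upwards [eventually_norm_pow_le_of_spectralRadius_le_one hx hr1] with n hn
  rw [norm_norm, smul_pow, norm_smul, mul_pow, Real.norm_of_nonneg (by positivity)]
  gcongr

lemma isUnit_one_add_of_summable_norm_pow {M : Type*} [CStarAlgebra M] {y : M}
    (hy : Summable fun n : ℕ => ‖y ^ n‖) : IsUnit (1 + y) := by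
  have h : Summable fun n : ℕ => (-y) ^ n := by
    refine Summable.of_norm_bounded hy fun n => ?_
    rw [← neg_one_smul ℝ y, smul_pow, norm_smul]
    simp
  have h1 := h.tsum_pow_mul_one_sub
  have h2 := h.one_sub_mul_tsum_pow
  rw [sub_neg_eq_add] at h1 h2
  exact isUnit_iff_exists.2 ⟨_, h2, h1⟩

namespace IsRealTrace_s5

variable {ρ : M →L[ℝ] ℝ} (hρ : IsRealTrace_s5 ρ)
include hρ

/-- Two paths of strictly positive elements with the same logarithmic derivatives have the same
increment of `ρ ∘ log`. -/
lemma log_sub_eq {g h g' h' k l : ℝ → M}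
    (hg : ∀ t, HasDerivAt g (g' t) t) (hh : ∀ t, HasDerivAt h (h' t) t)
    (hgp : ∀ t ∈ Set.Icc (0 : ℝ) 1, IsStrictlyPositive (g t))
    (hhp : ∀ t ∈ Set.Icc (0 : ℝ) 1, IsStrictlyPositive (h t))
    (hk : ∀ t ∈ Set.Icc (0 : ℝ) 1, k t * g t = 1)
    (hl : ∀ t ∈ Set.Icc (0 : ℝ) 1, l t * h t = 1)
    (heq : ∀ t ∈ Set.Icc (0 : ℝ) 1, ρ (k t * g' t) = ρ (l t * h' t)) :
    ρ (CFC.log (g 1)) - ρ (CFC.log (h 1)) = ρ (CFC.log (g 0)) - ρ (CFC.log (h 0)) := by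
  have hd : ∀ t ∈ Set.Icc (0 : ℝ) 1, HasDerivWithinAt
      (fun t => ρ (CFC.log (g t)) - ρ (CFC.log (h t))) 0 (Set.Icc 0 1) t := by
    intro t ht
    refine ((hρ.hasDerivWithinAt_log (hg t).hasDerivWithinAt hgp ht (hk t ht)).sub
      (hρ.hasDerivWithinAt_log (hh t).hasDerivWithinAt hhp ht (hl t ht))).congr_deriv ?_
    rw [heq t ht, sub_self]
  exact constant_of_has_deriv_right_zero (fun t ht => (hd t ht).continuousWithinAt)
    (fun t ht => (hd t (Set.Ico_subset_Icc_self ht)).mono_of_mem_nhdsWithin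
      (Icc_mem_nhdsGE_of_mem ht)) 1 (Set.right_mem_Icc.2 zero_le_one)

/-- Multiplicativity of the Fuglede–Kadison determinant. -/
lemma log_star_mul_mul {b q : M} (hb : IsUnit b) (hq : IsStrictlyPositive q) :
    ρ (CFC.log (star b * q * b)) = ρ (CFC.log (star b * b)) + ρ (CFC.log q) := by
  have := hρ.nontrivial
  let p : ℝ → M := fun t => (1 - t) • 1 + t • q
  have hp : ∀ t ∈ Set.Icc (0 : ℝ) 1, IsStrictlyPositive (p t) := by
    intro t ht
    rcases ht.1.eq_or_lt with rfl | ht0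
    · simp [p, isStrictlyPositive_one]
    · exact (hq.smul ht0).nonneg_add (smul_nonneg (sub_nonneg.2 ht.2) zero_le_one)
  have hpd : ∀ t, HasDerivAt p (q - 1) t := by
    intro t
    have h := (((hasDerivAt_id t).const_sub 1).smul_const (1 : M)).add
      ((hasDerivAt_id t).smul_const q)
    refine h.congr_deriv ?_
    simp [sub_eq_neg_add]
  have hinv : ∀ t ∈ Set.Icc (0 : ℝ) 1, Ring.inverse (p t) * p t = 1 := fun t ht =>
    Ring.inverse_mul_cancel _ (hp t ht).isUnit
  have hb1 := Ring.inverse_mul_cancel _ hb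
  have hb2 := Ring.mul_inverse_cancel _ hb
  have hb3 := Ring.inverse_mul_cancel _ hb.star
  have h := hρ.log_sub_eq (g := fun t => star b * p t * b) (h := p)
    (k := fun t => Ring.inverse b * (Ring.inverse (p t) * Ring.inverse (star b)))
    (l := fun t => Ring.inverse (p t))
    (fun t => ((hpd t).const_mul (star b)).mul_const b) hpd
    (fun t ht => hb.isStrictlyPositive_star_left_conjugate_iff.2 (hp t ht)) hp
    (fun t ht => by
      calc _ = Ring.inverse b * (Ring.inverse (p t) * (Ring.inverse (star b) * star b) * p t) * b := by
            noncomm_ring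
        _ = 1 := by rw [hb3, mul_one, hinv t ht, mul_one, hb1])
    hinv
    (fun t ht => by
      calc _ = ρ (Ring.inverse b * (Ring.inverse (p t) * (Ring.inverse (star b) * star b) *
              (q - 1) * b)) := by congr 1; noncomm_ring
        _ = ρ (Ring.inverse (p t) * (q - 1) * (b * Ring.inverse b)) := by
            rw [hρ.tracial, hb3, mul_one, mul_assoc _ b]
        _ = _ := by rw [hb2, mul_one])
  simp only [p, sub_self, zero_smul, one_smul, zero_add, sub_zero, add_zero, mul_one,
    CFC.log_one, map_zero] at h
  linarith

omit [StarOrderedRing M] in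
lemma map_pow_star_mul_self_comm (x : M) (α β : ℝ) (n : ℕ) :
    ρ ((α • 1 + β • (star x * x)) ^ n) = ρ ((α • 1 + β • (x * star x)) ^ n) := by
  have hcomm : ∀ n : ℕ, (α • 1 + β • (star x * x)) ^ n * star x =
      star x * (α • 1 + β • (x * star x)) ^ n := by
    intro n
    have : SemiconjBy (star x) (α • 1 + β • (x * star x)) (α • 1 + β • (star x * x)) := by
      simp [SemiconjBy, mul_add, add_mul, mul_assoc]
    exact (this.pow_right n).eq.symm
  induction n with
  | zero => simp
  | succ n ih =>
    rw [pow_succ, pow_succ, mul_add, mul_add, map_add, map_add]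
    simp only [mul_smul_comm, mul_one, map_smul, ih]
    rw [← mul_assoc, hcomm, mul_assoc, hρ.tracial, mul_assoc]

lemma log_star_mul_self_add_comm (x : M) {δ : ℝ} (hδ : 0 < δ) :
    ρ (CFC.log (star x * x + δ • 1)) = ρ (CFC.log (x * star x + δ • 1)) := by
  have := hρ.nontrivial
  have hc : 0 < ‖x‖ ^ 2 + δ := by positivity
  have h1 : IsStrictlyPositive (star x * x + δ • 1) :=
    (isStrictlyPositive_smul_one hδ).nonneg_add (star_mul_self_nonneg x)
  have h2 : IsStrictlyPositive (x * star x + δ • 1) :=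
    (isStrictlyPositive_smul_one hδ).nonneg_add (mul_star_self_nonneg x)
  have e1 : star x * x + δ • 1 ≤ algebraMap ℝ M (‖x‖ ^ 2 + δ) := by
    rw [map_add, Algebra.algebraMap_eq_smul_one δ]
    exact add_le_add_left CStarAlgebra.star_mul_le_algebraMap_norm_sq _
  have e2 : x * star x + δ • 1 ≤ algebraMap ℝ M (‖x‖ ^ 2 + δ) := by
    rw [map_add, Algebra.algebraMap_eq_smul_one δ]
    exact add_le_add_left CStarAlgebra.mul_star_le_algebraMap_norm_sq _
  rw [hρ.log_eq_logSeries h1 hc (norm_one_sub_lt_one h1 hc e1),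
    hρ.log_eq_logSeries h2 hc (norm_one_sub_lt_one h2 hc e2), logSeries, logSeries]
  congr 2
  ext n
  have hform : ∀ y : M, 1 - (‖x‖ ^ 2 + δ)⁻¹ • (y + δ • 1) =
      (1 - (‖x‖ ^ 2 + δ)⁻¹ * δ) • 1 + (-(‖x‖ ^ 2 + δ)⁻¹) • y := by
    intro y
    module
  rw [hform, hform, hρ.map_pow_star_mul_self_comm]

/-- If all moments of `y` vanish and its powers are summable, then `1 + y` has determinant one. -/
lemma log_star_mul_self_one_add {y : M} (hy : Summable fun n : ℕ => ‖y ^ n‖)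
    (hmom : ∀ n : ℕ, ρ (y ^ (n + 1)) = 0) :
    ρ (CFC.log (star (1 + y) * (1 + y))) = 0 := by
  let b : ℝ → M := fun t => 1 + t • y
  let c : ℝ → M := fun t => ∑' n : ℕ, (-(t • y)) ^ n
  have hsum : ∀ t ∈ Set.Icc (0 : ℝ) 1, Summable fun n : ℕ => (-(t • y)) ^ n := by
    intro t ht
    refine Summable.of_norm_bounded hy fun n => ?_
    rw [← neg_smul, smul_pow, norm_smul, norm_pow, norm_neg, Real.norm_of_nonneg ht.1]
    exact mul_le_of_le_one_left (norm_nonneg _) (pow_le_one₀ ht.1 ht.2)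
  have hcb : ∀ t ∈ Set.Icc (0 : ℝ) 1, c t * b t = 1 := by
    intro t ht
    have := (hsum t ht).tsum_pow_mul_one_sub
    rwa [sub_neg_eq_add] at this
  have hbc : ∀ t ∈ Set.Icc (0 : ℝ) 1, b t * c t = 1 := by
    intro t ht
    have := (hsum t ht).one_sub_mul_tsum_pow
    rwa [sub_neg_eq_add] at this
  have hbd : ∀ t, HasDerivAt b y t := by
    intro t
    refine (((hasDerivAt_id t).smul_const y).const_add 1).congr_deriv ?_
    simp
  have hcy : ∀ t ∈ Set.Icc (0 : ℝ) 1, ρ (y * c t) = 0 := by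
    intro t ht
    rw [← (hsum t ht).tsum_mul_left, ρ.map_tsum ((hsum t ht).mul_left y)]
    refine (tsum_congr fun n => ?_).trans tsum_zero
    rw [← neg_smul, smul_pow, mul_smul_comm, map_smul, ← pow_succ', hmom, smul_zero]
  have h := hρ.log_sub_eq (g := fun t => star (b t) * b t) (h := fun _ => 1)
    (g' := fun t => star y * b t + star (b t) * y) (h' := fun _ => 0)
    (k := fun t => c t * star (c t)) (l := fun _ => 1)
    (fun t => (hbd t).star.mul (hbd t)) (fun t => hasDerivAt_const t 1)
    (fun t ht => isStrictlyPositive_star_mul_self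
      (isUnit_iff_exists.2 ⟨c t, hbc t ht, hcb t ht⟩))
    (fun t ht => isStrictlyPositive_one)
    (fun t ht => by
      calc _ = c t * star (b t * c t) * b t := by rw [star_mul]; noncomm_ring
        _ = 1 := by rw [hbc t ht, star_one, mul_one, hcb t ht])
    (fun t ht => by simp)
    (fun t ht => by
      have e1 : ρ (c t * star (c t) * (star y * b t)) = 0 := by
        calc _ = ρ (c t * (star (c t) * star y * b t)) := by simp only [mul_assoc]
          _ = ρ (star (y * c t) * (b t * c t)) := by
            rw [hρ.tracial, star_mul, mul_assoc _ (b t)]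
          _ = 0 := by rw [hbc t ht, mul_one, hρ.map_star, hcy t ht]
      have e2 : ρ (c t * star (c t) * (star (b t) * y)) = 0 := by
        calc _ = ρ (c t * star (b t * c t) * y) := by rw [star_mul]; simp only [mul_assoc]
          _ = 0 := by rw [hbc t ht, star_one, mul_one, hρ.tracial, hcy t ht]
      simp [mul_add, e1, e2])
  simpa [b] using h

end IsRealTrace_s5

lemma le_smul_one_of_norm_le {a : M} (ha : IsSelfAdjoint a) {c : ℝ} (h : ‖a‖ ≤ c) :
    a ≤ c • 1 := by
  rw [← Algebra.algebraMap_eq_smul_one]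
  exact ha.le_algebraMap_norm_self.trans (algebraMap_mono M h)

/-- Rota's construction: an element with a contractive power is a contraction for an equivalent
norm, given by a positive element `P`. -/
lemma exists_one_le_star_mul_mul_le_s5 {z : M} {N : ℕ} (hN : 0 < N) (hz : ‖z ^ N‖ ≤ 1) :
    ∃ P : M, 1 ≤ P ∧ star z * P * z ≤ P := by
  refine ⟨∑ k ∈ Finset.range N, star (z ^ k) * z ^ k, ?_, ?_⟩
  · have h := Finset.single_le_sum (f := fun k => star (z ^ k) * z ^ k)
      (fun k _ => star_mul_self_nonneg (z ^ k)) (Finset.mem_range.2 hN)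
    simpa using h
  · have h1 : star z * (∑ k ∈ Finset.range N, star (z ^ k) * z ^ k) * z =
        ∑ k ∈ Finset.range N, star (z ^ (k + 1)) * z ^ (k + 1) := by
      rw [Finset.mul_sum, Finset.sum_mul]
      refine Finset.sum_congr rfl fun k _ => ?_
      rw [pow_succ, star_mul]
      simp only [mul_assoc]
    have h2 := Finset.sum_range_succ' (fun k => star (z ^ k) * z ^ k) N
    rw [Finset.sum_range_succ] at h2
    have h3 : star (z ^ N) * z ^ N ≤ 1 := by
      refine (le_smul_one_of_norm_le (IsSelfAdjoint.star_mul_self _) (c := 1) ?_).trans_eq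
        (one_smul _ _)
      rw [CStarRing.norm_star_mul_self]
      exact mul_le_one₀ hz (norm_nonneg _) hz
    rw [h1]
    simp only [pow_zero, star_one, mul_one] at h2
    have h4 := add_le_add_right h3 (∑ k ∈ Finset.range N, star (z ^ k) * z ^ k)
    rw [h2] at h4
    exact le_of_add_le_add_right h4

/-- The operator form of the estimate `|1 + R w| ≤ (1 + R) / (1 + t) * |1 + t w|` for `|w| ≤ 1`. -/
lemma star_mul_mul_one_add_le {P z : M} (hP : 0 ≤ P) (hz : star z * P * z ≤ P) {t R : ℝ}
    (ht : 0 < t) (htR : t ≤ R) (hRt : R * t ≤ 1) :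
    star (1 + R • z) * P * (1 + R • z) ≤
      ((1 + R) / (1 + t)) ^ 2 • (star (1 + t • z) * P * (1 + t • z)) := by
  have h1 : 0 ≤ star (1 - z) * P * (1 - z) := star_left_conjugate_nonneg hP _
  have h2 : 0 ≤ P - star z * P * z := sub_nonneg.2 hz
  have hβ : 0 ≤ (R - t) * (1 - R * t) / (1 + t) ^ 2 := by
    have := sub_nonneg.2 htR
    have := sub_nonneg.2 hRt
    positivity
  have hγ : 0 ≤ (1 + R) * (R - t) / (1 + t) := by
    have := sub_nonneg.2 htR
    have : 0 ≤ R := ht.le.trans htR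
    positivity
  have h3 := add_nonneg (smul_nonneg hβ h1) (smul_nonneg hγ h2)
  rw [← sub_nonneg]
  refine h3.trans_eq ?_
  have ht1 : 1 + t ≠ 0 := by positivity
  simp only [star_add, star_sub, star_one, star_smul, star_trivial, add_mul, mul_add, sub_mul,
    mul_sub, one_mul, mul_one, smul_mul_assoc, mul_smul_comm]
  match_scalars <;> field_simp <;> ring

namespace IsRealTrace_s5

variable {ρ : M →L[ℝ] ℝ} (hρ : IsRealTrace_s5 ρ)
include hρ

lemma log_add_log_le {P S : M} (hP : IsStrictlyPositive P) {C δ : ℝ} (hC : 0 < C) (hδ : 0 < δ)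
    (hPC : P ≤ C • 1) :
    ρ (CFC.log P) + ρ (CFC.log (star S * S + (δ / C) • 1)) ≤
      ρ (CFC.log (star S * P * S + δ • 1)) := by
  set p := CFC.sqrt P
  have hpu : IsUnit p := hP.sqrt.isUnit
  have hps : star p = p := (IsSelfAdjoint.of_nonneg (CFC.sqrt_nonneg P)).star_eq
  have hpp : p * p = P := CFC.sqrt_mul_sqrt_self P hP.nonneg
  have hδC : 0 < δ / C := by positivity
  have hq : IsStrictlyPositive (S * star S + (δ / C) • 1) :=
    (isStrictlyPositive_smul_one hδC).nonneg_add (mul_star_self_nonneg S)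
  have h1 := hρ.log_star_mul_mul hpu hq
  have h2 := hρ.log_star_mul_self_add_comm (p * S) hδ
  have e1 : star (p * S) * (p * S) = star S * P * S := by
    rw [star_mul, hps, ← hpp]; simp only [mul_assoc]
  rw [hps, hpp] at h1
  rw [hρ.log_star_mul_self_add_comm S hδC, ← h1, ← e1, h2]
  refine hρ.log_le_log (by
    have := hpu.isStrictlyPositive_star_left_conjugate_iff.2 hq
    rwa [hps] at this) ?_
  have e2 : p * (S * star S + (δ / C) • 1) * p = p * S * star (p * S) + (δ / C) • P := by
    rw [star_mul, hps, mul_add, add_mul, mul_smul_comm, mul_one, smul_mul_assoc, hpp]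
    simp only [mul_assoc]
  rw [e2]
  refine add_le_add_right ?_ _
  have := smul_le_smul_of_nonneg_left hPC hδC.le
  rwa [smul_smul, div_mul_cancel₀ _ hC.ne'] at this

variable {x : M} (hx : spectralRadius ℂ x ≤ 1) (hmom : ∀ n : ℕ, ρ (x ^ (n + 1)) = 0)
include hx hmom

lemma log_star_mul_self_one_add_smul {s : ℝ} (hs0 : 0 < s) (hs : s < 1) :
    ρ (CFC.log (star (1 + s • x) * (1 + s • x))) = 0 :=
  hρ.log_star_mul_self_one_add (summable_norm_smul_pow hx hs0 hs) fun n => by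
    rw [smul_pow, map_smul, hmom, smul_zero]

lemma log_star_mul_self_add_nonneg {δ : ℝ} (hδ : 0 < δ) :
    0 ≤ ρ (CFC.log (star (1 + x) * (1 + x) + δ • 1)) := by
  have hcont : Continuous fun s : ℝ =>
      ‖star (1 + s • x) * (1 + s • x) - star (1 + x) * (1 + x)‖ := by fun_prop
  have h0 := hcont.tendsto 1
  simp only [one_smul, sub_self, norm_zero] at h0
  have h1 : ∀ᶠ s : ℝ in 𝓝[<] 1, s ∈ Set.Ioo (0 : ℝ) 1 := Ioo_mem_nhdsLT one_pos
  obtain ⟨s, hs, hs0, hs1⟩ :=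
    ((h0.eventually_lt_const hδ).filter_mono nhdsWithin_le_nhds |>.and h1).exists
  rw [← hρ.log_star_mul_self_one_add_smul hx hmom hs0 hs1]
  refine hρ.log_le_log (isStrictlyPositive_star_mul_self
    (isUnit_one_add_of_summable_norm_pow (summable_norm_smul_pow hx hs0 hs1))) ?_
  have := le_smul_one_of_norm_le
    ((IsSelfAdjoint.star_mul_self (1 + s • x)).sub (IsSelfAdjoint.star_mul_self (1 + x))) hs.le
  rwa [sub_le_iff_le_add'] at this

lemma exists_log_star_mul_self_add_le {e : ℝ} (he : 0 < e) :
    ∃ δ : ℝ, 0 < δ ∧ ρ (CFC.log (star (1 + x) * (1 + x) + δ • 1)) ≤ e := by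
  have := hρ.nontrivial
  have hcont : ContinuousAt (fun t : ℝ => ((1 + (2 - t)) / (1 + t)) ^ 2) 1 := by
    fun_prop (disch := norm_num)
  have h0 : Tendsto (fun t : ℝ => ((1 + (2 - t)) / (1 + t)) ^ 2) (𝓝 1) (𝓝 1) := by
    convert hcont.tendsto using 2; norm_num
  have h1 : ∀ᶠ s : ℝ in 𝓝[<] 1, s ∈ Set.Ioo (0 : ℝ) 1 := Ioo_mem_nhdsLT one_pos
  obtain ⟨t, ht, ht0, ht1⟩ := ((h0.eventually_lt_const (Real.one_lt_exp_iff.2 he)).filter_mono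
    nhdsWithin_le_nhds |>.and h1).exists
  obtain ⟨R, rfl⟩ : ∃ R, t = 2 - R := ⟨2 - t, by ring⟩
  rw [sub_sub_cancel] at ht
  have hR1 : 1 < R := by linarith
  have hR0 : 0 < R := by linarith
  obtain ⟨N, hN, hN0⟩ := ((eventually_norm_pow_le_of_spectralRadius_le_one hx hR1).and
    (eventually_gt_atTop 0)).exists
  have hz : ‖(R⁻¹ • x) ^ N‖ ≤ 1 := by
    rw [smul_pow, norm_smul, norm_pow, Real.norm_of_nonneg (by positivity), inv_pow]
    exact inv_mul_le_one_of_le₀ hN (by positivity)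
  obtain ⟨P, hP1, hPz⟩ := exists_one_le_star_mul_mul_le_s5 hN0 hz
  have hP : IsStrictlyPositive P := isStrictlyPositive_one.of_le hP1
  have hcomp := star_mul_mul_one_add_le hP.nonneg hPz ht0 (by linarith : 2 - R ≤ R)
    (by nlinarith [sq_nonneg (R - 1)])
  rw [smul_smul, smul_smul, mul_inv_cancel₀ hR0.ne', one_smul] at hcomp
  set s := (2 - R) * R⁻¹
  have hs0 : 0 < s := by positivity
  have hs1 : s < 1 := by
    change (2 - R) * R⁻¹ < 1
    rw [← div_eq_mul_inv, div_lt_one hR0]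
    linarith
  have hbu : IsUnit (1 + s • x) :=
    isUnit_one_add_of_summable_norm_pow (summable_norm_smul_pow hx hs0 hs1)
  have hbP := hbu.isStrictlyPositive_star_left_conjugate_iff.2 hP
  obtain ⟨m, hm, hmb⟩ := exists_pos_algebraMap_le hbP
  rw [Algebra.algebraMap_eq_smul_one] at hmb
  set K := ((1 + R) / (1 + (2 - R))) ^ 2
  have hδ : 0 < m * (Real.exp e - K) := mul_pos hm (sub_pos.2 ht)
  have hC : 0 < ‖P‖ + 1 := by positivity
  refine ⟨m * (Real.exp e - K) / (‖P‖ + 1), div_pos hδ hC, ?_⟩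
  have h2 := hρ.log_add_log_le (S := 1 + x) hP hC hδ
    (le_smul_one_of_norm_le hP.isSelfAdjoint (by simp))
  have h3 : star (1 + x) * P * (1 + x) + (m * (Real.exp e - K)) • 1 ≤
      Real.exp e • (star (1 + s • x) * P * (1 + s • x)) := by
    have h4 := add_le_add hcomp (smul_le_smul_of_nonneg_left hmb (sub_pos.2 ht).le)
    rwa [← add_smul, add_sub_cancel, smul_smul, mul_comm _ m] at h4
  have h5 := hρ.log_le_log ((isStrictlyPositive_smul_one hδ).nonneg_add
    (star_left_conjugate_nonneg hP.nonneg (1 + x))) h3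
  rw [hρ.log_smul hbP (Real.exp_pos e), Real.log_exp, hρ.log_star_mul_mul hbu hP,
    hρ.log_star_mul_self_one_add_smul hx hmom hs0 hs1] at h5
  linarith

/-- Elements with vanishing moments and spectral radius at most one satisfy the ball-Jensen
equality. -/
lemma iInf_exp_log_eq_one :
    ⨅ ε : {ε : ℝ // 0 < ε}, Real.exp (ρ (CFC.log (cstarAbs (1 + x) + (ε : ℝ) • 1))) = 1 := by
  set a := cstarAbs (1 + x)
  have ha : 0 ≤ a := CFC.sqrt_nonneg _
  have haa : a * a = star (1 + x) * (1 + x) :=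
    CFC.sqrt_mul_sqrt_self _ (star_mul_self_nonneg _)
  have hsq : ∀ ε : ℝ, (a + ε • 1) ^ 2 = star (1 + x) * (1 + x) + (2 * ε) • a + ε ^ 2 • 1 := by
    intro ε
    rw [← haa, sq]
    simp only [add_mul, mul_add, smul_mul_assoc, mul_smul_comm, mul_one, one_mul]
    module
  have hpos : ∀ ε : ℝ, 0 < ε → IsStrictlyPositive (a + ε • 1) := fun ε hε =>
    (isStrictlyPositive_smul_one hε).nonneg_add ha
  have hlog : ∀ ε : ℝ, 0 < ε →
      ρ (CFC.log ((a + ε • 1) ^ 2)) = 2 * ρ (CFC.log (a + ε • 1)) := by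
    intro ε hε
    rw [CFC.log_pow' 2 _ (hpos ε hε), map_nsmul]
    simp
  have hpos' : ∀ δ : ℝ, 0 < δ → IsStrictlyPositive (star (1 + x) * (1 + x) + δ • 1) :=
    fun δ hδ => (isStrictlyPositive_smul_one hδ).nonneg_add (star_mul_self_nonneg _)
  have : Nonempty {ε : ℝ // 0 < ε} := ⟨⟨1, one_pos⟩⟩
  apply le_antisymm
  · refine le_of_forall_gt_imp_ge_of_dense fun c hc => ?_
    obtain ⟨δ, hδ, hle⟩ := hρ.exists_log_star_mul_self_add_le hx hmom
      (mul_pos two_pos (Real.log_pos hc))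
    obtain ⟨ε, hε, hεδ⟩ : ∃ ε : ℝ, 0 < ε ∧ 2 * ε * ‖a‖ + ε ^ 2 < δ := by
      have hcont : Continuous fun ε : ℝ => 2 * ε * ‖a‖ + ε ^ 2 := by fun_prop
      have h0 := hcont.tendsto 0
      simp only [mul_zero, zero_mul, add_zero, ne_eq, OfNat.ofNat_ne_zero, not_false_eq_true,
        zero_pow] at h0
      obtain ⟨ε, h1, h2⟩ := ((h0.eventually_lt_const hδ).filter_mono
        nhdsWithin_le_nhds |>.and (self_mem_nhdsWithin (s := Set.Ioi (0 : ℝ)))).exists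
      exact ⟨ε, h2, h1⟩
    refine (ciInf_le ⟨0, Set.forall_mem_range.2 fun ε => (Real.exp_pos _).le⟩
      (⟨ε, hε⟩ : {ε : ℝ // 0 < ε})).trans ?_
    rw [← Real.le_log_iff_exp_le (one_pos.trans hc)]
    have h1 := hρ.log_le_log (a := (a + ε • 1) ^ 2) (b := star (1 + x) * (1 + x) + δ • 1) (by
      rw [hsq, add_assoc, add_comm ((2 * ε) • a), ← add_assoc]
      exact (hpos' _ (by positivity)).add_nonneg (smul_nonneg (by positivity) ha)) (by
      rw [hsq, add_assoc]
      refine add_le_add_right ?_ _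
      have h2 := smul_le_smul_of_nonneg_left
        (le_smul_one_of_norm_le (IsSelfAdjoint.of_nonneg ha) le_rfl) (by positivity : 0 ≤ 2 * ε)
      refine (add_le_add_left h2 _).trans ?_
      rw [smul_smul, ← add_smul]
      exact smul_le_smul_of_nonneg_right hεδ.le zero_le_one)
    rw [hlog ε hε] at h1
    linarith
  · refine le_ciInf fun ⟨ε, hε⟩ => Real.one_le_exp ?_
    have h1 := hρ.log_star_mul_self_add_nonneg hx hmom (pow_pos hε 2)
    have h2 := hρ.log_le_log (hpos' _ (pow_pos hε 2)) (b := (a + ε • 1) ^ 2) (by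
      rw [hsq]
      exact add_le_add_left (le_add_of_nonneg_right (smul_nonneg (by positivity) ha)) _)
    rw [hlog ε hε] at h2
    change 0 ≤ ρ (CFC.log (a + ε • 1))
    linarith

end IsRealTrace_s5

end LogTrace

/-- Let `M` be a unital C*-algebra with a tracial state `τ`, `D` a C*-subalgebra
of `M` containing the unit, `A` a unital subalgebra of `M` containing `D`, and `Φ : A → D` a
unital algebra homomorphism restricting to the identity on `D` and preserving `τ`. Then `A`
satisfies the ball-Jensen equality: `Δ_τ(1 + x) = 1` for every `x ∈ A` with `Φ(x) = 0` and
`r(x) ≤ 1`. -/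
theorem ball_jensen_equality
    {M : Type*} [CStarAlgebra M] [PartialOrder M] [StarOrderedRing M]
    (τ : M →ₗ[ℂ] ℂ)
    (hτ1 : τ 1 = 1)
    (hτpos : ∀ a : M, 0 ≤ a → 0 ≤ τ a)
    (hτtr : ∀ a b : M, τ (a * b) = τ (b * a))
    (D A : Subalgebra ℂ M)
    (hDstar : ∀ d ∈ D, star d ∈ D)
    (hDclosed : IsClosed (D : Set M))
    (hDA : D ≤ A)
    (Φ : ↥A →ₐ[ℂ] M)
    (hΦD : ∀ a : ↥A, Φ a ∈ D)
    (hΦid : ∀ d : M, ∀ hd : d ∈ D, Φ ⟨d, hDA hd⟩ = d)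
    (hΦτ : ∀ a : ↥A, τ (Φ a) = τ (a : M)) :
    ∀ x : ↥A, Φ x = 0 → spectralRadius ℂ (x : M) ≤ 1 → fkDet τ (1 + (x : M)) = 1 := by
  intro x hx hr
  let T : M →ₚ[ℂ] ℂ := PositiveLinearMap.mk₀ τ hτpos
  have hstar : ∀ a : M, τ (star a) = star (τ a) := fun a => map_star T a
  have hcont : Continuous τ := map_continuous T
  let ρ : M →L[ℝ] ℝ := Complex.reCLM ∘L ((⟨τ, hcont⟩ : M →L[ℂ] ℂ).restrictScalars ℝ)
  have hρτ : ∀ a : M, ρ a = (τ a).re := fun _ => rfl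
  have hρ : IsRealTrace_s5 ρ :=
    { map_one := by rw [hρτ, hτ1, Complex.one_re]
      nonneg := fun a ha => (Complex.nonneg_iff.1 (hτpos a ha)).1
      tracial := fun a b => by rw [hρτ, hρτ, hτtr]
      map_star := fun a => by rw [hρτ, hρτ, hstar, Complex.star_def, Complex.conj_re] }
  refine hρ.iInf_exp_log_eq_one hr fun n => ?_
  have h := hΦτ (x ^ (n + 1))
  rw [map_pow, hx, zero_pow n.succ_ne_zero, map_zero, SubmonoidClass.coe_pow] at h
  rw [hρτ, ← h, Complex.zero_re]
end
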